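/- arXiv:0910.0749 — 2 statements merged into one kernel-verified Lean document; each statement's English description precedes it below -/
import Mathlib

section
/- Let α > 1 be a fixed constant, m = ⌊n^α⌋, and let ω = ω(n) be a sequence of reals with ω = o(ln n) allowed to tend to ±∞. Set p₁ = √((ln n + ω)/(n·m)) (for α > 1) and, in the case 0 < α ≤ 1, set p₁ = (ln n + ω)/m. Then: (i) if ω → −∞, then with high probability the random intersection graph G(n,m,p₁) is disconnected; (ii) if ω → ∞, then with high probability G(n,m,p₁) is connected. -/
open scoped Classical
open Filter

noncomputable section

/-- The (simple) graph determined by a feature assignment `W` on vertex set `Fin n`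
with feature set `Fin m`: two distinct vertices are adjacent iff their feature sets
intersect. -/
def rigGraph (n m : ℕ) (W : Fin n → Finset (Fin m)) : SimpleGraph (Fin n) :=
  SimpleGraph.fromRel (fun u v => ((W u) ∩ (W v)).Nonempty)

/-- The probability of the feature assignment `W` when each of the `m` features is
included in each vertex's feature set independently with probability `p`. -/
def assignWeight (n m : ℕ) (p : ℝ) (W : Fin n → Finset (Fin m)) : ℝ :=
  ∏ v : Fin n, p ^ (W v).card * (1 - p) ^ (m - (W v).card)

/-- The probability that the random intersection graph `G(n,m,p)` lies in the set `A`. -/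
def rigProb (n m : ℕ) (p : ℝ) (A : Set (SimpleGraph (Fin n))) : ℝ :=
  ∑ W : Fin n → Finset (Fin m), if rigGraph n m W ∈ A then assignWeight n m p W else 0

section BipartiteModel

variable {V F : Type*} [Fintype V] [DecidableEq V] [Fintype F] [DecidableEq F]

/-- The probability of the subset `A` when each element is included independently with
probability `p`. -/
def subsetWeight (p : ℝ) (A : Finset F) : ℝ := ∏ w, if w ∈ A then p else 1 - p

/-- The probability that a binomial random subset satisfies `E`. -/
def subsetProb (p : ℝ) (E : Finset F → Prop) : ℝ :=
  ∑ A, if E A then subsetWeight p A else 0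

/-- The probability that a family of independent binomial random subsets satisfies `E`. -/
def familyProb (p : ℝ) (E : (V → Finset F) → Prop) : ℝ :=
  ∑ W, if E W then ∏ v, subsetWeight p (W v) else 0

lemma sum_prod_ite_mem (f g : F → ℝ) :
    ∑ A : Finset F, ∏ w, (if w ∈ A then f w else g w) = ∏ w, (f w + g w) := by
  rw [Finset.prod_add, Finset.powerset_univ]
  refine Finset.sum_congr rfl fun A _ => ?_
  rw [Finset.prod_ite]
  congr 1
  · refine Finset.prod_congr (by ext; simp) fun _ _ => rfl
  · refine Finset.prod_congr (by ext; simp) fun _ _ => rfl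

lemma sum_subsetWeight (p : ℝ) : ∑ A : Finset F, subsetWeight p A = 1 := by
  simp [subsetWeight, sum_prod_ite_mem]

lemma subsetWeight_nonneg {p : ℝ} (h0 : 0 ≤ p) (h1 : p ≤ 1) (A : Finset F) :
    0 ≤ subsetWeight p A :=
  Finset.prod_nonneg fun w _ => by split_ifs <;> linarith

lemma subsetWeight_eq (p : ℝ) (A : Finset F) :
    subsetWeight p A = p ^ A.card * (1 - p) ^ (Fintype.card F - A.card) := by
  rw [subsetWeight, Finset.prod_ite, Finset.prod_const, Finset.prod_const]
  congr 2
  · congr 1; ext; simp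
  · rw [← Finset.card_compl]; congr 1; ext; simp

lemma subsetProb_subset (p : ℝ) (T : Finset F) :
    subsetProb p (fun A => A ⊆ T) = (1 - p) ^ Tᶜ.card := by
  have h : ∀ A : Finset F, (if A ⊆ T then subsetWeight p A else 0) =
      ∏ w, if w ∈ A then (if w ∈ T then p else 0) else 1 - p := by
    intro A
    split_ifs with hA
    · refine Finset.prod_congr rfl fun w _ => ?_
      by_cases hw : w ∈ A
      · simp [hw, hA hw]
      · simp [hw]
    · obtain ⟨w, hw, hwT⟩ := Finset.not_subset.1 hA
      exact (Finset.prod_eq_zero (Finset.mem_univ w) (by simp [hw, hwT])).symm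
  have h2 : ∀ w, (if w ∈ T then p else 0) + (1 - p) = if w ∈ Tᶜ then 1 - p else 1 := by
    intro w
    by_cases hw : w ∈ T <;> simp [hw]
  calc subsetProb p (fun A => A ⊆ T) = _ := Finset.sum_congr rfl fun A _ => by
        convert h A
    _ = ∏ w, if w ∈ Tᶜ then 1 - p else 1 := by
        rw [sum_prod_ite_mem]; exact Finset.prod_congr rfl fun w _ => h2 w
    _ = _ := by rw [Finset.prod_ite_mem]; simp

lemma subsetProb_eq_singleton (p : ℝ) (B : Finset F) :
    subsetProb p (fun A => A = B) = subsetWeight p B := by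
  rw [subsetProb, Finset.sum_eq_single B]
  · simp
  · intro A _ hA; simp [hA]
  · simp

lemma subsetProb_congr {p : ℝ} {E E' : Finset F → Prop} (h : ∀ A, E A ↔ E' A) :
    subsetProb p E = subsetProb p E' := by
  rw [show E = E' from funext fun A => propext (h A)]

lemma subsetProb_or_add_and (p : ℝ) (E E' : Finset F → Prop) :
    subsetProb p (fun A => E A ∨ E' A) + subsetProb p (fun A => E A ∧ E' A) =
      subsetProb p E + subsetProb p E' := by
  simp only [subsetProb, ← Finset.sum_add_distrib]
  refine Finset.sum_congr rfl fun A _ => ?_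
  by_cases h : E A <;> by_cases h' : E' A <;> simp [h, h']

lemma subsetProb_or_of_disjoint (p : ℝ) {E E' : Finset F → Prop} (h : ∀ A, E A → ¬ E' A) :
    subsetProb p (fun A => E A ∨ E' A) = subsetProb p E + subsetProb p E' := by
  rw [← subsetProb_or_add_and]
  have : subsetProb p (fun A => E A ∧ E' A) = 0 :=
    Finset.sum_eq_zero fun A _ => if_neg fun hA => h A hA.1 hA.2
  rw [this, add_zero]

/-- The probability that a random subset does not split along `T`. -/
lemma subsetProb_not_split (p : ℝ) (T : Finset F) :
    subsetProb p (fun A => A ⊆ T ∨ A ⊆ Tᶜ) =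
      1 - (1 - (1 - p) ^ T.card) * (1 - (1 - p) ^ (Fintype.card F - T.card)) := by
  have h := subsetProb_or_add_and p (fun A => A ⊆ T) (fun A => A ⊆ Tᶜ)
  have h2 : subsetProb p (fun A => A ⊆ T ∧ A ⊆ Tᶜ) = (1 - p) ^ Fintype.card F := by
    rw [subsetProb_congr (E' := fun A => A ⊆ (∅ : Finset F)), subsetProb_subset]
    · simp
    · intro A
      rw [← Finset.subset_inter_iff, Finset.inter_compl]
  have h3 : (1 - p) ^ Fintype.card F =
      (1 - p) ^ T.card * (1 - p) ^ (Fintype.card F - T.card) := by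
    rw [← pow_add, Nat.add_sub_cancel' (Finset.card_le_univ T)]
  rw [h2, subsetProb_subset, subsetProb_subset, compl_compl, Finset.card_compl, h3] at h
  linear_combination h

/-- The probability that a random subset does not contain `u` together with another element. -/
lemma subsetProb_isolated (p : ℝ) (u : F) :
    subsetProb p (fun A => u ∈ A → A = {u}) =
      (1 - p) + p * (1 - p) ^ (Fintype.card F - 1) := by
  rw [subsetProb_congr (E' := fun A => A ⊆ {u}ᶜ ∨ A = {u}), subsetProb_or_of_disjoint,
    subsetProb_subset, subsetProb_eq_singleton, subsetWeight_eq]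
  · simp
  · rintro A h rfl
    simp at h
  · intro A
    have hs : A ⊆ {u}ᶜ ↔ u ∉ A := by rw [Finset.subset_compl_comm]; simp
    rw [hs, imp_iff_not_or]

lemma subsetProb_isolated_pair (p : ℝ) {u v : F} (huv : u ≠ v) :
    subsetProb p (fun A => (u ∈ A → A = {u}) ∧ (v ∈ A → A = {v})) =
      (1 - p) ^ 2 + 2 * (p * (1 - p) ^ (Fintype.card F - 1)) := by
  rw [subsetProb_congr (E' := fun A => (A ⊆ {u, v}ᶜ ∨ A = {u}) ∨ A = {v}),
    subsetProb_or_of_disjoint, subsetProb_or_of_disjoint,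
    subsetProb_subset, subsetProb_eq_singleton, subsetProb_eq_singleton, subsetWeight_eq,
    subsetWeight_eq]
  · simp [Finset.card_pair huv]; ring
  · rintro A h rfl
    simp at h
  · rintro A (h | h) rfl
    · simp at h
    · simp [huv.symm] at h
  · intro A
    have hs : A ⊆ {u, v}ᶜ ↔ u ∉ A ∧ v ∉ A := by
      rw [Finset.subset_compl_comm]; simp [Finset.insert_subset_iff]
    rw [hs]
    constructor
    · rintro ⟨h1, h2⟩
      by_cases hu : u ∈ A
      · exact Or.inl (Or.inr (h1 hu))
      · by_cases hv : v ∈ A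
        · exact Or.inr (h2 hv)
        · exact Or.inl (Or.inl ⟨hu, hv⟩)
    · rintro ((⟨h1, h2⟩ | rfl) | rfl)
      · exact ⟨fun h => absurd h h1, fun h => absurd h h2⟩
      · simp [huv.symm]
      · simp [huv]

lemma familyProb_congr {p : ℝ} {E E' : (V → Finset F) → Prop} (h : ∀ W, E W ↔ E' W) :
    familyProb p E = familyProb p E' := by
  rw [show E = E' from funext fun A => propext (h A)]

lemma familyWeight_nonneg {p : ℝ} (h0 : 0 ≤ p) (h1 : p ≤ 1) (W : V → Finset F) :
    0 ≤ ∏ v, subsetWeight p (W v) :=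
  Finset.prod_nonneg fun v _ => subsetWeight_nonneg h0 h1 (W v)

/-- The sets of the family are independent. -/
lemma familyProb_forall_eq_prod (p : ℝ) (E : V → Finset F → Prop) :
    familyProb p (fun W : V → Finset F => ∀ v, E v (W v)) = ∏ v, subsetProb p (E v) := by
  have h := Finset.prod_univ_sum (fun _ : V => (Finset.univ : Finset (Finset F)))
    (fun v A => if E v A then subsetWeight p A else 0)
  rw [Fintype.piFinset_univ] at h
  simp only [subsetProb]
  rw [h, familyProb]
  refine Finset.sum_congr rfl fun W _ => ?_
  split_ifs with hW
  · exact Finset.prod_congr rfl fun v _ => by simp [hW v]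
  · push Not at hW
    obtain ⟨v, hv⟩ := hW
    exact (Finset.prod_eq_zero (Finset.mem_univ v) (by simp [hv])).symm

lemma familyProb_forall (p : ℝ) (E : Finset F → Prop) :
    familyProb p (fun W : V → Finset F => ∀ v, E (W v)) = subsetProb p E ^ Fintype.card V := by
  rw [familyProb_forall_eq_prod p fun _ => E, Finset.prod_const, Finset.card_univ]

lemma familyProb_apply (p : ℝ) (v : V) (E : Finset F → Prop) :
    familyProb p (fun W : V → Finset F => E (W v)) = subsetProb p E := by
  rw [familyProb_congr (E' := fun W => ∀ u, u = v → E (W u)) (fun W => by simp),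
    familyProb_forall_eq_prod p fun u A => u = v → E A, Finset.prod_eq_single v]
  · exact subsetProb_congr fun A => by simp
  · intro u _ hu
    simp [subsetProb, hu, sum_subsetWeight]
  · simp

lemma sum_familyWeight (p : ℝ) :
    ∑ W : V → Finset F, ∏ v, subsetWeight p (W v) = 1 := by
  have h := familyProb_forall (V := V) (F := F) p (fun _ => True)
  simpa [familyProb, subsetProb, sum_subsetWeight] using h

lemma familyProb_not (p : ℝ) (E : (V → Finset F) → Prop) :
    familyProb p (fun W => ¬ E W) = 1 - familyProb p E := by
  rw [eq_sub_iff_add_eq, familyProb, familyProb, ← Finset.sum_add_distrib,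
    ← sum_familyWeight (V := V) (F := F) p]
  refine Finset.sum_congr rfl fun W _ => ?_
  by_cases h : E W <;> simp [h]

lemma familyProb_nonneg {p : ℝ} (h0 : 0 ≤ p) (h1 : p ≤ 1) (E : (V → Finset F) → Prop) :
    0 ≤ familyProb p E :=
  Finset.sum_nonneg fun W _ => by
    split_ifs
    · exact familyWeight_nonneg h0 h1 W
    · exact le_rfl

lemma familyProb_mono {p : ℝ} (h0 : 0 ≤ p) (h1 : p ≤ 1) {E E' : (V → Finset F) → Prop}
    (h : ∀ W, E W → E' W) : familyProb p E ≤ familyProb p E' := by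
  refine Finset.sum_le_sum fun W _ => ?_
  have := familyWeight_nonneg h0 h1 W
  by_cases hE : E W
  · simp [hE, h W hE]
  · rw [if_neg hE]; split_ifs <;> simp [this]

lemma familyProb_or_le {p : ℝ} (h0 : 0 ≤ p) (h1 : p ≤ 1) (E E' : (V → Finset F) → Prop) :
    familyProb p (fun W => E W ∨ E' W) ≤ familyProb p E + familyProb p E' := by
  simp only [familyProb, ← Finset.sum_add_distrib]
  refine Finset.sum_le_sum fun W _ => ?_
  have := familyWeight_nonneg h0 h1 W
  by_cases h : E W <;> by_cases h' : E' W <;> simp [h, h', this]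

lemma familyProb_exists_le {p : ℝ} (h0 : 0 ≤ p) (h1 : p ≤ 1) {ι : Type*} (s : Finset ι)
    (E : ι → (V → Finset F) → Prop) :
    familyProb p (fun W => ∃ i ∈ s, E i W) ≤ ∑ i ∈ s, familyProb p (E i) := by
  simp only [familyProb]
  rw [Finset.sum_comm]
  refine Finset.sum_le_sum fun W _ => ?_
  have hw := familyWeight_nonneg h0 h1 W
  have hnn : ∀ i ∈ s, 0 ≤ if E i W then ∏ v, subsetWeight p (W v) else 0 := fun i _ => by
    split_ifs <;> simp [hw]
  split_ifs with h
  · obtain ⟨i, hi, hE⟩ := h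
    refine le_trans ?_ (Finset.single_le_sum hnn hi)
    simp [hE]
  · exact Finset.sum_nonneg hnn

/-- The family of sets on `V` dual to a family of sets on `F`. -/
def dualFamily (W : V → Finset F) : F → Finset V := fun w => {v | w ∈ W v}

lemma mem_dualFamily {W : V → Finset F} {v : V} {w : F} : v ∈ dualFamily W w ↔ w ∈ W v := by
  simp [dualFamily]

lemma familyProb_dual (p : ℝ) (E : (F → Finset V) → Prop) :
    familyProb p (fun W : V → Finset F => E (dualFamily W)) = familyProb p E := by
  let e : (V → Finset F) ≃ (F → Finset V) :=
    { toFun := dualFamily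
      invFun := dualFamily
      left_inv := fun W => by ext; simp [mem_dualFamily]
      right_inv := fun W => by ext; simp [mem_dualFamily] }
  rw [familyProb, familyProb, ← e.sum_comp]
  refine Finset.sum_congr rfl fun W _ => ?_
  have : ∏ v, subsetWeight p (W v) = ∏ w, subsetWeight p (e W w) := by
    simp only [subsetWeight]
    rw [Finset.prod_comm]
    refine Finset.prod_congr rfl fun w _ => Finset.prod_congr rfl fun v _ => ?_
    have : v ∈ e W w ↔ w ∈ W v := mem_dualFamily
    simp [this]
  rw [this]
  rfl

/-- The expected number of nontrivial sets of at most `N / 2` elements along which none of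
`M` random subsets of an `N`-element set splits. -/
def cutBound (N M : ℕ) (p : ℝ) : ℝ :=
  ∑ t ∈ Finset.range (N + 1), (N.choose t : ℝ) *
    (if 1 ≤ t ∧ 2 * t ≤ N then (1 - (1 - (1 - p) ^ t) * (1 - (1 - p) ^ (N - t))) ^ M else 0)

lemma familyProb_exists_cut_le {p : ℝ} (h0 : 0 ≤ p) (h1 : p ≤ 1) :
    familyProb p (fun W : V → Finset F =>
      ∃ T : Finset F, T.Nonempty ∧ Tᶜ.Nonempty ∧ ∀ v, W v ⊆ T ∨ W v ⊆ Tᶜ) ≤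
      cutBound (Fintype.card F) (Fintype.card V) p := by
  let s : Finset (Finset F) := {T | 1 ≤ T.card ∧ 2 * T.card ≤ Fintype.card F}
  have hsub : ∀ W : V → Finset F,
      (∃ T : Finset F, T.Nonempty ∧ Tᶜ.Nonempty ∧ ∀ v, W v ⊆ T ∨ W v ⊆ Tᶜ) →
      ∃ T ∈ s, ∀ v, W v ⊆ T ∨ W v ⊆ Tᶜ := by
    rintro W ⟨T, hT, hTc, h⟩
    have hc := Finset.card_add_card_compl T
    have hp := hT.card_pos
    have hpc := hTc.card_pos
    by_cases hle : 2 * T.card ≤ Fintype.card F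
    · exact ⟨T, by simp only [s, Finset.mem_filter_univ]; omega, h⟩
    · refine ⟨Tᶜ, by simp only [s, Finset.mem_filter_univ]; omega, fun v => ?_⟩
      rw [compl_compl]
      exact (h v).symm
  refine (familyProb_mono h0 h1 hsub).trans ((familyProb_exists_le h0 h1 s _).trans ?_)
  have hsum := Finset.sum_powerset_apply_card (x := (Finset.univ : Finset F)) (fun t => if 1 ≤ t ∧ 2 * t ≤ Fintype.card F then
    (1 - (1 - (1 - p) ^ t) * (1 - (1 - p) ^ (Fintype.card F - t))) ^ Fintype.card V else 0)
  simp only [nsmul_eq_mul, Finset.card_univ] at hsum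
  rw [cutBound, ← hsum, Finset.powerset_univ, Finset.sum_filter]
  refine (Finset.sum_le_sum fun T _ => ?_)
  split_ifs
  · rw [familyProb_forall p (fun A => A ⊆ T ∨ A ⊆ Tᶜ), subsetProb_not_split]
  · exact le_rfl

end BipartiteModel

section SecondMoment

variable {V F ι : Type*} [Fintype V] [DecidableEq V] [Fintype F] [DecidableEq F]

lemma familyProb_none_mul_le [Fintype ι] [DecidableEq ι] {p : ℝ} (h0 : 0 ≤ p) (h1 : p ≤ 1)
    (E : ι → (V → Finset F) → Prop) {a b : ℝ} (ha : ∀ i, familyProb p (E i) = a)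
    (hb : ∀ i j, i ≠ j → familyProb p (fun W => E i W ∧ E j W) ≤ b) :
    familyProb p (fun W => ∀ i, ¬ E i W) * (Fintype.card ι * a) ^ 2 ≤
      Fintype.card ι * a + Fintype.card ι * (Fintype.card ι - 1) * b -
        (Fintype.card ι * a) ^ 2 := by
  set N : ℝ := (Fintype.card ι : ℝ) with hN
  let wt : (V → Finset F) → ℝ := fun W => ∏ v, subsetWeight p (W v)
  let X : (V → Finset F) → ℝ := fun W => ∑ i, if E i W then 1 else 0
  have hwt : ∀ W, 0 ≤ wt W := familyWeight_nonneg h0 h1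
  have hX1 : ∑ W, wt W * X W = N * a := by
    simp only [X, Finset.mul_sum]
    rw [Finset.sum_comm]
    simp only [mul_ite, mul_one, mul_zero]
    exact (Finset.sum_congr rfl fun i _ => ha i).trans (by simp [hN])
  have hX2 : ∑ W, wt W * X W ^ 2 ≤ N * a + N * (N - 1) * b := by
    have hexp : ∑ W, wt W * X W ^ 2 =
        ∑ i, ∑ j, familyProb p (fun W => E i W ∧ E j W) := by
      have hsq : ∀ W, wt W * X W ^ 2 = ∑ i, ∑ j, if E i W ∧ E j W then wt W else 0 := by
        intro W
        simp only [X]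
        rw [sq, Finset.sum_mul_sum, Finset.mul_sum]
        refine Finset.sum_congr rfl fun i _ => ?_
        rw [Finset.mul_sum]
        refine Finset.sum_congr rfl fun j _ => ?_
        by_cases hi : E i W <;> by_cases hj : E j W <;> simp [hi, hj]
      rw [Finset.sum_congr rfl fun W _ => hsq W, Finset.sum_comm]
      refine Finset.sum_congr rfl fun i _ => ?_
      rw [Finset.sum_comm]
      refine Finset.sum_congr rfl fun j _ => Finset.sum_congr rfl fun W _ => ?_
      congr
    rw [hexp]
    have hrow : ∀ i, ∑ j, familyProb p (fun W => E i W ∧ E j W) ≤ a + (N - 1) * b := by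
      intro i
      rw [← Finset.add_sum_erase _ _ (Finset.mem_univ i)]
      refine add_le_add (le_of_eq ((familyProb_congr fun W => and_self_iff).trans (ha i))) ?_
      refine (Finset.sum_le_card_nsmul _ _ b fun j hj =>
        hb i j (Finset.ne_of_mem_erase hj).symm).trans (le_of_eq ?_)
      have : 0 < Fintype.card ι := Fintype.card_pos_iff.2 ⟨i⟩
      rw [Finset.card_erase_of_mem (Finset.mem_univ i), nsmul_eq_mul, Finset.card_univ,
        Nat.cast_sub this, Nat.cast_one]
    refine (Finset.sum_le_card_nsmul _ _ _ fun i _ => hrow i).trans (le_of_eq ?_)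
    rw [nsmul_eq_mul, Finset.card_univ]
    ring
  have hvar : ∑ W, wt W * (X W - N * a) ^ 2 =
      ∑ W, wt W * X W ^ 2 - 2 * (N * a) * ∑ W, wt W * X W + (N * a) ^ 2 * ∑ W, wt W := by
    simp only [Finset.mul_sum, ← Finset.sum_sub_distrib, ← Finset.sum_add_distrib]
    exact Finset.sum_congr rfl fun W _ => by ring
  have hcheb : familyProb p (fun W => ∀ i, ¬ E i W) * (N * a) ^ 2 ≤
      ∑ W, wt W * (X W - N * a) ^ 2 := by
    rw [familyProb, Finset.sum_mul]
    refine Finset.sum_le_sum fun W _ => ?_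
    split_ifs with h
    · have : X W = 0 := Finset.sum_eq_zero fun i _ => if_neg (h i)
      rw [this]
      exact le_of_eq (by ring)
    · rw [zero_mul]
      exact mul_nonneg (hwt W) (sq_nonneg _)
  have hw1 : ∑ W, wt W = 1 := sum_familyWeight p
  rw [hvar, hX1, hw1] at hcheb
  nlinarith

/-- Second moment bound for the probability that every element of `F` shares one of the sets of
the family with another element. -/
lemma familyProb_no_isolated_le {p : ℝ} (h0 : 0 ≤ p) (h1 : p ≤ 1 / 2)
    (hF : 0 < Fintype.card F) :
    familyProb p (fun W : V → Finset F => ∀ u, ¬ ∀ v, u ∈ W v → W v = {u}) ≤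
      1 / (Fintype.card F * ((1 - p) + p * (1 - p) ^ (Fintype.card F - 1)) ^ Fintype.card V) +
        (Real.exp (8 * (Fintype.card V * p ^ 2)) - 1) := by
  set N : ℝ := (Fintype.card F : ℝ) with hN
  set M := Fintype.card V
  set r : ℝ := (1 - p) ^ (Fintype.card F - 1) with hr
  have hr0 : 0 ≤ r := pow_nonneg (by linarith) _
  have hr1 : r ≤ 1 := pow_le_one₀ (by linarith) (by linarith)
  set c : ℝ := (1 - p) + p * r with hc
  have hc2 : 1 / 2 ≤ c := by have := mul_nonneg h0 hr0; linarith
  have hN1 : 1 ≤ N := by rw [hN]; exact_mod_cast hF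
  have ha0 : 0 < c ^ M := pow_pos (by linarith) _
  have hb : (1 - p) ^ 2 + 2 * (p * r) ≤ c ^ 2 * Real.exp (8 * p ^ 2) := by
    have he := Real.add_one_le_exp (8 * p ^ 2)
    have h2 : c ^ 2 * (8 * p ^ 2 + 1) ≤ c ^ 2 * Real.exp (8 * p ^ 2) := by gcongr
    have h3 : 2 * p ^ 2 ≤ c ^ 2 * (8 * p ^ 2) := by
      have : 1 / 4 ≤ c ^ 2 := by nlinarith
      nlinarith [sq_nonneg p]
    have h4 : (1 - p) ^ 2 + 2 * (p * r) ≤ c ^ 2 + 2 * p ^ 2 := by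
      rw [hc]
      nlinarith [mul_le_mul_of_nonneg_left hr1 (sq_nonneg p), sq_nonneg (p * r)]
    linarith
  have hB : ((1 - p) ^ 2 + 2 * (p * r)) ^ M ≤ (c ^ M) ^ 2 * Real.exp (8 * (M * p ^ 2)) := by
    refine (pow_le_pow_left₀ (by positivity) hb M).trans (le_of_eq ?_)
    rw [mul_pow, ← Real.exp_nat_mul]
    ring_nf
  have key := familyProb_none_mul_le (V := V) (F := F) h0 (by linarith)
    (fun (u : F) W => ∀ v, u ∈ W v → W v = {u}) (a := c ^ M)
    (b := (c ^ M) ^ 2 * Real.exp (8 * (M * p ^ 2)))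
    (fun u => by
      rw [familyProb_forall p (fun A => u ∈ A → A = {u}), subsetProb_isolated])
    (fun u u' huu => by
      refine le_trans (le_of_eq ?_) hB
      rw [hr, ← subsetProb_isolated_pair p huu, ← familyProb_forall]
      exact familyProb_congr fun W => forall_and.symm)
  rw [← hN] at key
  set a := c ^ M
  set e := Real.exp (8 * (M * p ^ 2))
  have hNa : 0 < N * a := by positivity
  have he1 : 0 ≤ e := (Real.exp_pos _).le
  have : (1 / (N * a) + (e - 1)) * (N * a) ^ 2 = N * a + (e - 1) * (N * a) ^ 2 := by
    field_simp
  refine le_of_mul_le_mul_right (key.trans ?_) (pow_pos hNa 2)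
  rw [this]
  nlinarith [mul_nonneg (mul_nonneg (by linarith : (0 : ℝ) ≤ N) he1) (sq_nonneg a)]

end SecondMoment

section Graph

variable {n m : ℕ}

lemma rigProb_eq_familyProb (p : ℝ) (A : Set (SimpleGraph (Fin n))) :
    rigProb n m p A = familyProb p (fun W => rigGraph n m W ∈ A) := by
  refine Finset.sum_congr rfl fun W _ => ?_
  have : assignWeight n m p W = ∏ v, subsetWeight p (W v) :=
    Finset.prod_congr rfl fun v _ => by rw [subsetWeight_eq, Fintype.card_fin]
  rw [this]

lemma rigGraph_adj {W : Fin n → Finset (Fin m)} {u v : Fin n} :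
    (rigGraph n m W).Adj u v ↔ u ≠ v ∧ ∃ w, w ∈ W u ∧ w ∈ W v := by
  rw [rigGraph, SimpleGraph.fromRel_adj, Finset.inter_comm (W v), or_self]
  simp [Finset.Nonempty]

lemma not_connected_of_isolated (hn : 2 ≤ n) {W : Fin n → Finset (Fin m)} {u : Fin n}
    (hu : ∀ w, u ∈ dualFamily W w → dualFamily W w = {u}) : ¬ (rigGraph n m W).Connected := by
  intro hconn
  have : Nontrivial (Fin n) := Fin.nontrivial_iff_two_le.2 hn
  obtain ⟨v, hv⟩ := hconn.preconnected.exists_adj_of_nontrivial u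
  obtain ⟨hne, w, hwu, hwv⟩ := rigGraph_adj.1 hv
  have h := hu w (mem_dualFamily.2 hwu)
  have hvw : v ∈ dualFamily W w := mem_dualFamily.2 hwv
  rw [h, Finset.mem_singleton] at hvw
  exact hne hvw.symm

/-- A disconnected random intersection graph has a vertex cut respected by every feature. -/
lemma exists_vertex_cut (hn : 0 < n) {W : Fin n → Finset (Fin m)}
    (h : ¬ (rigGraph n m W).Connected) :
    ∃ S : Finset (Fin n), S.Nonempty ∧ Sᶜ.Nonempty ∧
      ∀ w, dualFamily W w ⊆ S ∨ dualFamily W w ⊆ Sᶜ := by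
  have : Nonempty (Fin n) := ⟨⟨0, hn⟩⟩
  have hpre : ¬ (rigGraph n m W).Preconnected := fun hp => h ⟨hp⟩
  unfold SimpleGraph.Preconnected at hpre
  push Not at hpre
  obtain ⟨u, v, huv⟩ := hpre
  let S : Finset (Fin n) := {x | (rigGraph n m W).Reachable u x}
  have hS : ∀ x, x ∈ S ↔ (rigGraph n m W).Reachable u x := fun x => by simp [S]
  refine ⟨S, ⟨u, (hS u).2 (SimpleGraph.Reachable.refl u)⟩,
    ⟨v, Finset.mem_compl.2 fun hv => huv ((hS v).1 hv)⟩, fun w => ?_⟩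
  by_contra! hw
  obtain ⟨h1, h2⟩ := hw
  obtain ⟨x, hxw, hx⟩ := Finset.not_subset.1 h1
  obtain ⟨y, hyw, hy⟩ := Finset.not_subset.1 h2
  rw [Finset.mem_compl, not_not] at hy
  have hne : y ≠ x := fun hyx => hx (hyx ▸ hy)
  have hadj : (rigGraph n m W).Adj y x :=
    rigGraph_adj.2 ⟨hne, w, mem_dualFamily.1 hyw, mem_dualFamily.1 hxw⟩
  exact hx ((hS x).2 (((hS y).1 hy).trans hadj.reachable))

/-- A disconnected random intersection graph has a vertex without features or a feature cut
respected by every vertex. -/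
lemma exists_empty_or_feature_cut (hn : 0 < n) {W : Fin n → Finset (Fin m)}
    (h : ¬ (rigGraph n m W).Connected) :
    (∃ v ∈ Finset.univ, W v ⊆ ∅) ∨
    ∃ T : Finset (Fin m), T.Nonempty ∧ Tᶜ.Nonempty ∧ ∀ v, W v ⊆ T ∨ W v ⊆ Tᶜ := by
  rw [or_iff_not_imp_left]
  intro hne
  push Not at hne
  have hne' : ∀ v, (W v).Nonempty := fun v => by
    rw [Finset.nonempty_iff_ne_empty]
    exact fun h0 => hne v (Finset.mem_univ v) (by rw [h0])
  obtain ⟨S, ⟨u, hu⟩, ⟨v, hv⟩, hS⟩ := exists_vertex_cut hn h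
  have hmem : ∀ x y w, x ∈ S → y ∉ S → w ∈ W x → w ∉ W y := fun x y w hx hy hwx hwy => by
    rcases hS w with h | h
    · exact hy (h (mem_dualFamily.2 hwy))
    · exact Finset.mem_compl.1 (h (mem_dualFamily.2 hwx)) hx
  rw [Finset.mem_compl] at hv
  refine ⟨S.biUnion W, ?_, ?_, fun x => ?_⟩
  · obtain ⟨w, hw⟩ := hne' u
    exact ⟨w, Finset.mem_biUnion.2 ⟨u, hu, hw⟩⟩
  · obtain ⟨w, hw⟩ := hne' v
    refine ⟨w, Finset.mem_compl.2 fun hw' => ?_⟩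
    obtain ⟨x, hx, hwx⟩ := Finset.mem_biUnion.1 hw'
    exact hmem x v w hx hv hwx hw
  · by_cases hx : x ∈ S
    · exact Or.inl (Finset.subset_biUnion_of_mem W hx)
    · refine Or.inr fun w hw => Finset.mem_compl.2 fun hw' => ?_
      obtain ⟨y, hy, hwy⟩ := Finset.mem_biUnion.1 hw'
      exact hmem y x w hy hx hwy hw

lemma rigProb_not_connected (p : ℝ) :
    rigProb n m p {G | ¬ G.Connected} = 1 - rigProb n m p {G | G.Connected} := by
  rw [rigProb_eq_familyProb, rigProb_eq_familyProb]
  exact familyProb_not p _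

lemma rigProb_nonneg {p : ℝ} (h0 : 0 ≤ p) (h1 : p ≤ 1) (A : Set (SimpleGraph (Fin n))) :
    0 ≤ rigProb n m p A := by
  rw [rigProb_eq_familyProb]
  exact familyProb_nonneg h0 h1 _

lemma rigProb_connected_le {p : ℝ} (h0 : 0 ≤ p) (h1 : p ≤ 1 / 2) (hn : 2 ≤ n) :
    rigProb n m p {G | G.Connected} ≤
      1 / (n * ((1 - p) + p * (1 - p) ^ (n - 1)) ^ m) + (Real.exp (8 * (m * p ^ 2)) - 1) := by
  have h := familyProb_no_isolated_le (V := Fin m) (F := Fin n) h0 h1 (by simp; omega)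
  rw [Fintype.card_fin, Fintype.card_fin, ← familyProb_dual] at h
  rw [rigProb_eq_familyProb]
  refine (familyProb_mono h0 (by linarith) fun W hW u hu => ?_).trans h
  exact not_connected_of_isolated hn hu hW

lemma rigProb_not_connected_le_vertex_cut {p : ℝ} (h0 : 0 ≤ p) (h1 : p ≤ 1) (hn : 0 < n) :
    rigProb n m p {G | ¬ G.Connected} ≤ cutBound n m p := by
  have h := familyProb_exists_cut_le (V := Fin m) (F := Fin n) h0 h1
  rw [Fintype.card_fin, Fintype.card_fin, ← familyProb_dual] at h
  rw [rigProb_eq_familyProb]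
  exact (familyProb_mono h0 h1 fun W hW => exists_vertex_cut hn hW).trans h

lemma rigProb_not_connected_le_feature_cut {p : ℝ} (h0 : 0 ≤ p) (h1 : p ≤ 1) (hn : 0 < n) :
    rigProb n m p {G | ¬ G.Connected} ≤ n * (1 - p) ^ m + cutBound m n p := by
  have h := familyProb_exists_cut_le (V := Fin n) (F := Fin m) h0 h1
  rw [Fintype.card_fin, Fintype.card_fin] at h
  have h2 := familyProb_exists_le (V := Fin n) (F := Fin m) h0 h1 Finset.univ
    (fun v W => W v ⊆ ∅)
  have h3 : ∀ v : Fin n, familyProb p (fun W : Fin n → Finset (Fin m) => W v ⊆ ∅) =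
      (1 - p) ^ m := fun v => by
    rw [familyProb_apply p v (fun A => A ⊆ ∅), subsetProb_subset]
    simp
  rw [Finset.sum_congr rfl fun v _ => h3 v] at h2
  rw [rigProb_eq_familyProb]
  refine (familyProb_mono h0 h1 fun W hW => exists_empty_or_feature_cut hn hW).trans
    ((familyProb_or_le h0 h1 _ _).trans (add_le_add (h2.trans (by simp)) h))

end Graph

section CutEstimate

open Real

lemma one_sub_one_sub_pow_ge {p : ℝ} (h0 : 0 ≤ p) (h1 : p ≤ 1) (t : ℕ) :
    t * p / (1 + t * p) ≤ 1 - (1 - p) ^ t := by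
  have htp : 0 ≤ t * p := by positivity
  have h : (1 - p) ^ t ≤ 1 / (1 + t * p) := by
    calc (1 - p) ^ t ≤ exp (-p) ^ t :=
          pow_le_pow_left₀ (by linarith) (by linarith [add_one_le_exp (-p)]) t
      _ = 1 / exp (t * p) := by rw [← exp_nat_mul, mul_neg, exp_neg, one_div]
      _ ≤ _ := one_div_le_one_div_of_le (by linarith) (by linarith [add_one_le_exp (t * p)])
  have h2 : t * p / (1 + t * p) = 1 - 1 / (1 + t * p) := by field_simp; ring
  linarith

lemma choose_le_exp_mul_log {N t : ℕ} (hN : 0 < N) (ht : 0 < t) :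
    (N.choose t : ℝ) ≤ exp (t * (1 + log N - log t)) := by
  have hN' : (0 : ℝ) < N := by exact_mod_cast hN
  have ht' : (0 : ℝ) < t := by exact_mod_cast ht
  have h1 := Nat.choose_le_pow_div (α := ℝ) t N
  have h2 := Real.pow_div_factorial_le_exp (t : ℝ) ht'.le t
  have h3 : exp (t * (1 + log N - log t)) = (N : ℝ) ^ t * exp t / (t : ℝ) ^ t := by
    rw [show (t : ℝ) * (1 + log N - log t) = t * log N + t - t * log t by ring, exp_sub, exp_add,
      exp_nat_mul, exp_nat_mul, exp_log hN', exp_log ht']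
  rw [h3]
  refine h1.trans ?_
  rw [div_le_iff₀ (by positivity)] at h2
  rw [div_le_div_iff₀ (by positivity) (by positivity)]
  nlinarith [pow_pos hN' t]

lemma choose_le_exp_mul_log' {N t : ℕ} (hN : 0 < N) :
    (N.choose t : ℝ) ≤ exp (t * log N) := by
  rw [exp_nat_mul, exp_log (by exact_mod_cast hN)]
  exact_mod_cast Nat.choose_le_pow N t

lemma cutBound_term_le {N M t : ℕ} {p w : ℝ} (h0 : 0 ≤ p) (h1 : p ≤ 1) (hNM : N ≤ M)
    (hA : (log N + w) * (1 + N * p) ≤ M * N * p ^ 2) (hw : 0 ≤ w)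
    (hδ : (N : ℝ) ^ (-(1 / 50) : ℝ) * (1 + N * p) ≤ 1 / 2)
    (hδlog : (N : ℝ) ^ (-(1 / 50) : ℝ) * (1 + N * p) * log N ≤ 1)
    (ht : 1 ≤ t) (htN : 2 * t ≤ N) :
    (N.choose t : ℝ) * (1 - (1 - (1 - p) ^ t) * (1 - (1 - p) ^ (N - t))) ^ M ≤
      exp (1 - w / 2) ^ t + exp (1 - log N / 36) ^ t +
        N.choose t * exp (-(79 / 100) * N) := by
  have hN : 0 < N := by omega
  have hN' : (0 : ℝ) < N := by exact_mod_cast hN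
  have ht' : (1 : ℝ) ≤ t := by exact_mod_cast ht
  have htN' : 2 * (t : ℝ) ≤ N := by exact_mod_cast htN
  have hNM' : (N : ℝ) ≤ M := by exact_mod_cast hNM
  have hlogN : 0 ≤ log N := log_natCast_nonneg N
  have hsub : ((N - t : ℕ) : ℝ) = N - t := Nat.cast_sub (by omega)
  set f : ℝ := (1 - (1 - p) ^ t) * (1 - (1 - p) ^ (N - t)) with hf
  set x : ℝ := t * p with hx
  set y : ℝ := (N - t) * p with hy
  have hx0 : 0 ≤ x := by positivity
  have hxy : x ≤ y := mul_le_mul_of_nonneg_right (by linarith) h0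
  have hy0 : 0 ≤ y := hx0.trans hxy
  have hyN : y ≤ N * p := mul_le_mul_of_nonneg_right (by linarith) h0
  have hfx : x / (1 + x) ≤ 1 - (1 - p) ^ t := one_sub_one_sub_pow_ge h0 h1 t
  have hfy : y / (1 + y) ≤ 1 - (1 - p) ^ (N - t) := by
    have := one_sub_one_sub_pow_ge h0 h1 (N - t)
    rwa [hsub] at this
  have hf1 : f ≤ 1 := by
    have ha := pow_nonneg (by linarith : 0 ≤ 1 - p) t
    have hb := pow_nonneg (by linarith : 0 ≤ 1 - p) (N - t)
    have hb' := pow_le_one₀ (n := N - t) (by linarith : 0 ≤ 1 - p) (by linarith)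
    exact mul_le_one₀ (by linarith) (by linarith) (by linarith)
  have hfge : x / (1 + x) * (y / (1 + y)) ≤ f :=
    mul_le_mul hfx hfy (by positivity) ((by positivity : 0 ≤ x / (1 + x)).trans hfx)
  have hpow : (1 - f) ^ M ≤ exp (-(M * f)) := by
    rw [← mul_neg, exp_nat_mul]
    exact pow_le_pow_left₀ (by linarith) (by linarith [add_one_le_exp (-f)]) M
  have hC0 : (0 : ℝ) ≤ N.choose t := Nat.cast_nonneg _
  refine (mul_le_mul_of_nonneg_left hpow hC0).trans ?_
  have hMf : t * ((1 - t / N) / (1 + x)) * (log N + w) ≤ M * f := by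
    have e1 : t * ((1 - t / N) / (1 + x)) * (log N + w) =
        t * (1 - t / N) * ((log N + w) * (1 + N * p)) / ((1 + x) * (1 + N * p)) := by
      field_simp
    have hone : 0 ≤ 1 - (t : ℝ) / N := by
      rw [sub_nonneg, div_le_one hN']; linarith
    have e2 : t * (1 - t / N) * (M * N * p ^ 2) = M * (x * y) := by
      rw [hx, hy]; field_simp
    calc _ ≤ t * (1 - t / N) * (M * N * p ^ 2) / ((1 + x) * (1 + N * p)) := by
          rw [e1]; gcongr
      _ = M * (x * y) / ((1 + x) * (1 + N * p)) := by rw [e2]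
      _ ≤ M * (x * y) / ((1 + x) * (1 + y)) := by gcongr
      _ = M * (x / (1 + x) * (y / (1 + y))) := by field_simp
      _ ≤ M * f := by gcongr
  have hr1 : 0 ≤ exp (1 - w / 2) ^ t := by positivity
  have hr2 : 0 ≤ exp (1 - log N / 36) ^ t := by positivity
  have hr3 : 0 ≤ N.choose t * exp (-(79 / 100) * N) := by positivity
  rcases le_or_gt (t : ℝ) (N * (N : ℝ) ^ (-(1 / 50) : ℝ)) with hsmall | hlarge
  · set δ := (N : ℝ) ^ (-(1 / 50) : ℝ) * (1 + N * p) with hδdef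
    have hδ0 : 0 ≤ δ := by positivity
    have htδ : t / N * (1 + N * p) ≤ δ := by
      have : (t : ℝ) / N ≤ (N : ℝ) ^ (-(1 / 50) : ℝ) := by
        rw [div_le_iff₀ hN']; linarith
      rw [hδdef]; gcongr
    have hx' : t / N * (1 + N * p) = t / N + x := by rw [hx]; field_simp
    have hfrac : 1 - δ ≤ (1 - t / N) / (1 + x) := by
      rw [le_div_iff₀ (by linarith)]
      linarith [mul_nonneg hδ0 hx0]
    have hlow : t * (log N + w / 2 - 1) ≤ M * f := by
      refine le_trans ?_ hMf
      rw [mul_assoc]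
      refine mul_le_mul_of_nonneg_left ?_ (by linarith)
      refine le_trans ?_ (mul_le_mul_of_nonneg_right hfrac (by linarith))
      linarith [mul_le_mul_of_nonneg_right hδ hw]
    have : N.choose t * exp (-(M * f)) ≤ exp (1 - w / 2) ^ t := by
      rw [← exp_nat_mul]
      refine (mul_le_mul_of_nonneg_right (choose_le_exp_mul_log' hN) (exp_pos _).le).trans ?_
      rw [← exp_add, exp_le_exp]
      linarith
    linarith
  · rcases le_or_gt x 8 with hx8 | hx8
    · have hlogt : (49 / 50) * log N ≤ log t := by
        have h := log_le_log (by positivity) hlarge.le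
        rw [log_mul hN'.ne' (by positivity), log_rpow hN'] at h
        linarith
      have hfrac : 1 / 18 ≤ (1 - t / N) / (1 + x) := by
        rw [le_div_iff₀ (by linarith)]
        have : (t : ℝ) / N ≤ 1 / 2 := by rw [div_le_iff₀ hN']; linarith
        linarith
      have hlow : t * (1 / 18 * log N) ≤ M * f := by
        refine le_trans ?_ hMf
        rw [mul_assoc]
        refine mul_le_mul_of_nonneg_left ?_ (by linarith)
        exact mul_le_mul hfrac (by linarith) hlogN (by linarith)
      have : N.choose t * exp (-(M * f)) ≤ exp (1 - log N / 36) ^ t := by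
        rw [← exp_nat_mul]
        refine (mul_le_mul_of_nonneg_right (choose_le_exp_mul_log hN ht)
          (exp_pos _).le).trans ?_
        rw [← exp_add, exp_le_exp]
        have h1 : t * (1 + log N - log t) ≤ t * (1 + log N / 50) := by gcongr; linarith
        linarith [mul_nonneg (by linarith : (0 : ℝ) ≤ t) hlogN]
      linarith
    · have h8 : ∀ z : ℝ, 8 < z → 8 / 9 ≤ z / (1 + z) := fun z hz => by
        rw [div_le_div_iff₀ (by norm_num) (by linarith)]; linarith
      have hf8 : 79 / 100 ≤ f := by
        have := mul_le_mul (h8 x hx8) (h8 y (by linarith)) (by norm_num) (by positivity)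
        linarith
      have hlow : 79 / 100 * (N : ℝ) ≤ M * f := by
        have := mul_le_mul hNM' hf8 (by norm_num) (by positivity)
        linarith
      have : N.choose t * exp (-(M * f)) ≤ N.choose t * exp (-(79 / 100) * N) := by
        gcongr
        linarith
      linarith

lemma sum_pow_le_two_mul {r : ℝ} (h0 : 0 ≤ r) (h1 : r ≤ 1 / 2) (k : ℕ) :
    ∑ t ∈ Finset.range k, (if 1 ≤ t then r ^ t else 0) ≤ 2 * r := by
  cases k with
  | zero => simpa using h0
  | succ k =>
    rw [Finset.sum_range_succ']
    simp only [Nat.le_add_left, if_true, pow_succ]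
    rw [← Finset.sum_mul]
    have h := (summable_geometric_of_lt_one h0 (by linarith)).sum_le_tsum (Finset.range k)
      (fun i _ => pow_nonneg h0 i)
    rw [tsum_geometric_of_lt_one h0 (by linarith)] at h
    have h2 : (1 - r)⁻¹ ≤ 2 := by
      rw [inv_le_comm₀ (by linarith) (by norm_num)]; linarith
    simp only [nonpos_iff_eq_zero, one_ne_zero, if_false, add_zero]
    exact mul_le_mul_of_nonneg_right (h.trans h2) h0

lemma cutBound_nonneg {N M : ℕ} {p : ℝ} (h0 : 0 ≤ p) (h1 : p ≤ 1) : 0 ≤ cutBound N M p := by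
  refine Finset.sum_nonneg fun t _ => mul_nonneg (Nat.cast_nonneg _) ?_
  split_ifs
  · have hq : ∀ s : ℕ, 0 ≤ (1 - p) ^ s ∧ (1 - p) ^ s ≤ 1 := fun s =>
      ⟨pow_nonneg (by linarith) s, pow_le_one₀ (by linarith) (by linarith)⟩
    have := mul_le_one₀ (a := 1 - (1 - p) ^ t) (b := 1 - (1 - p) ^ (N - t))
      (by linarith [(hq t).1]) (by linarith [(hq (N - t)).2]) (by linarith [(hq (N - t)).1])
    exact pow_nonneg (by linarith) M
  · exact le_rfl

lemma cutBound_le {N M : ℕ} {p w : ℝ} (h0 : 0 ≤ p) (h1 : p ≤ 1) (hNM : N ≤ M)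
    (hA : (log N + w) * (1 + N * p) ≤ M * N * p ^ 2) (hw : 4 ≤ w) (hN : 72 ≤ log N)
    (hδ : (N : ℝ) ^ (-(1 / 50) : ℝ) * (1 + N * p) ≤ 1 / 2)
    (hδlog : (N : ℝ) ^ (-(1 / 50) : ℝ) * (1 + N * p) * log N ≤ 1) :
    cutBound N M p ≤ 2 * exp (1 - w / 2) + 2 * exp (1 - log N / 36) +
      (2 * exp (-(79 / 100))) ^ N := by
  have hhalf : exp (-1) ≤ 1 / 2 := by
    rw [exp_neg, one_div]
    exact inv_anti₀ (by norm_num) (by linarith [add_one_le_exp (1 : ℝ)])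
  have hbin : ∑ t ∈ Finset.range (N + 1), (N.choose t : ℝ) * exp (-(79 / 100) * N) =
      (2 * exp (-(79 / 100))) ^ N := by
    rw [← Finset.sum_mul, mul_pow, ← exp_nat_mul, mul_comm (N : ℝ)]
    congr 1
    exact_mod_cast Nat.sum_range_choose N
  have hr1 := sum_pow_le_two_mul (exp_pos (1 - w / 2)).le
    ((exp_le_exp.2 (by linarith)).trans hhalf) (N + 1)
  have hr2 := sum_pow_le_two_mul (exp_pos (1 - log N / 36)).le
    ((exp_le_exp.2 (by linarith)).trans hhalf) (N + 1)
  refine le_trans ?_ (add_le_add (add_le_add hr1 hr2) hbin.le)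
  rw [cutBound, ← Finset.sum_add_distrib, ← Finset.sum_add_distrib]
  refine Finset.sum_le_sum fun t _ => ?_
  by_cases ht : 1 ≤ t ∧ 2 * t ≤ N
  · rw [if_pos ht, if_pos ht.1, if_pos ht.1]
    exact cutBound_term_le h0 h1 hNM hA (by linarith) hδ hδlog ht.1 ht.2
  · rw [if_neg ht, mul_zero]
    have : (0 : ℝ) ≤ (N.choose t : ℝ) * exp (-(79 / 100) * N) := by positivity
    split_ifs <;> positivity

end CutEstimate

section Asymptotics

open Real Topology

lemma tendsto_log_pow_mul_rpow_neg (k : ℕ) {s : ℝ} (hs : 0 < s) :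
    Tendsto (fun x : ℝ => log x ^ k * x ^ (-s)) atTop (𝓝 0) := by
  have h := (isLittleO_log_rpow_rpow_atTop (k : ℝ) hs).tendsto_div_nhds_zero
  refine h.congr' ?_
  filter_upwards [eventually_gt_atTop 0] with x hx
  rw [rpow_natCast, rpow_neg hx.le, div_eq_mul_inv]

lemma tendsto_pow_div_zero_of_le_log {L D : ℕ → ℝ} {s : ℝ} (hs : 0 < s) (k : ℕ)
    (hL : ∀ᶠ n : ℕ in atTop, 0 ≤ L n ∧ L n ≤ 2 * log n)
    (hD : ∀ᶠ n : ℕ in atTop, (n : ℝ) ^ s / 2 ≤ D n) :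
    Tendsto (fun n => L n ^ k / D n) atTop (𝓝 0) := by
  have h := ((tendsto_log_pow_mul_rpow_neg k hs).comp
    (tendsto_natCast_atTop_atTop (R := ℝ))).const_mul (2 ^ k * 2)
  rw [mul_zero] at h
  refine squeeze_zero' ?_ ?_ h
  · filter_upwards [hL, hD] with n hLn hDn
    have : 0 ≤ D n := le_trans (by positivity) hDn
    exact div_nonneg (pow_nonneg hLn.1 k) this
  · filter_upwards [hL, hD, eventually_gt_atTop 0] with n hLn hDn hn
    have hn' : (0 : ℝ) < n := by exact_mod_cast hn
    have hpos : 0 < (n : ℝ) ^ s := by positivity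
    calc L n ^ k / D n ≤ (2 * log n) ^ k / ((n : ℝ) ^ s / 2) := by
          have hln : 0 ≤ log n := log_natCast_nonneg n
          gcongr
          exacts [hLn.1, hLn.2]
      _ = 2 ^ k * 2 * (log n ^ k * (n : ℝ) ^ (-s)) := by
          rw [rpow_neg hn'.le, mul_pow]; field_simp

lemma tendsto_cutBound {N M : ℕ → ℕ} {p w : ℕ → ℝ} (C : ℝ) (hN : Tendsto N atTop atTop)
    (hNM : ∀ᶠ n in atTop, N n ≤ M n) (hp : ∀ᶠ n in atTop, 0 ≤ p n ∧ p n ≤ 1)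
    (hA : ∀ᶠ n in atTop, (log (N n) + w n) * (1 + N n * p n) ≤ M n * N n * p n ^ 2)
    (hw : Tendsto w atTop atTop)
    (hC : ∀ᶠ n in atTop, N n * p n ≤ C * (1 + log (N n))) :
    Tendsto (fun n => cutBound (N n) (M n) (p n)) atTop (𝓝 0) := by
  have hNr : Tendsto (fun n => (N n : ℝ)) atTop atTop := tendsto_natCast_atTop_atTop.comp hN
  have hlog : Tendsto (fun n => log (N n)) atTop atTop := tendsto_log_atTop.comp hNr
  have h50 : (0 : ℝ) < 1 / 50 := by norm_num
  have hk := fun k : ℕ => (tendsto_log_pow_mul_rpow_neg k h50).comp hNr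
  have hδ : Tendsto (fun n => (N n : ℝ) ^ (-(1 / 50) : ℝ) * (1 + C * (1 + log (N n))))
      atTop (𝓝 0) := by
    have h := ((hk 0).const_mul (1 + C)).add ((hk 1).const_mul C)
    simp only [mul_zero, add_zero] at h
    refine h.congr fun n => ?_
    simp only [Function.comp_apply]
    ring
  have hδlog : Tendsto (fun n => (N n : ℝ) ^ (-(1 / 50) : ℝ) * (1 + C * (1 + log (N n))) *
      log (N n)) atTop (𝓝 0) := by
    have h := ((hk 1).const_mul (1 + C)).add ((hk 2).const_mul C)
    simp only [mul_zero, add_zero] at h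
    refine h.congr fun n => ?_
    simp only [Function.comp_apply]
    ring
  have hr : 2 * exp (-(79 / 100)) < 1 := by
    have h2 : log 2 < 79 / 100 := by linarith [log_two_lt_d9]
    have : exp (-(79 / 100)) < exp (-log 2) := exp_lt_exp.2 (by linarith)
    rw [exp_neg (log 2), exp_log (by norm_num)] at this
    linarith
  have hexp : Tendsto (fun y : ℝ => exp (1 - y)) atTop (𝓝 0) :=
    tendsto_exp_atBot.comp (tendsto_atBot_add_const_left _ 1 tendsto_neg_atTop_atBot)
  have hlim : Tendsto (fun n => 2 * exp (1 - w n / 2) + 2 * exp (1 - log (N n) / 36) +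
      (2 * exp (-(79 / 100))) ^ N n) atTop (𝓝 0) := by
    have h1 := (hexp.comp (hw.atTop_div_const (by norm_num : (0 : ℝ) < 2))).const_mul 2
    have h2 := (hexp.comp (hlog.atTop_div_const (by norm_num : (0 : ℝ) < 36))).const_mul 2
    have h3 := (tendsto_pow_atTop_nhds_zero_of_lt_one (by positivity) hr).comp hN
    simpa using (h1.add h2).add h3
  refine squeeze_zero' ?_ ?_ hlim
  · filter_upwards [hp] with n hpn using cutBound_nonneg hpn.1 hpn.2
  · filter_upwards [hNM, hp, hA, hC, hw.eventually_ge_atTop 4, hlog.eventually_ge_atTop 72,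
      hδ.eventually_le_const (by norm_num : (0 : ℝ) < 1 / 2),
      hδlog.eventually_le_const (by norm_num : (0 : ℝ) < 1)]
      with n hNM hp hA hC hw hlog hδ hδlog
    have hle : (N n : ℝ) ^ (-(1 / 50) : ℝ) * (1 + N n * p n) ≤
        (N n : ℝ) ^ (-(1 / 50) : ℝ) * (1 + C * (1 + log (N n))) := by gcongr
    refine cutBound_le hp.1 hp.2 hNM hA hw hlog (hle.trans hδ) (le_trans ?_ hδlog)
    exact mul_le_mul_of_nonneg_right hle (by linarith)

lemma exp_neg_le_one_sub {x : ℝ} (h1 : x ≤ 1 / 2) :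
    exp (-(x + 2 * x ^ 2)) ≤ 1 - x := by
  rw [exp_neg, inv_le_comm₀ (exp_pos _) (by linarith)]
  refine le_trans ?_ (add_one_le_exp _)
  rw [inv_le_iff_one_le_mul₀ (by linarith)]
  nlinarith [mul_nonneg (sq_nonneg x) (by linarith : 0 ≤ 1 - 2 * x)]

/-- The graph is disconnected with high probability when the expected number of isolated vertices,
bounded below through `(1 - x) ^ m`, tends to infinity. -/
lemma tendsto_rigProb_connected_zero {m : ℕ → ℕ} {p x ω : ℕ → ℝ}
    (hp : ∀ᶠ n in atTop, 0 ≤ p n ∧ p n ≤ 1 / 2) (hx : ∀ᶠ n in atTop, 0 ≤ x n ∧ x n ≤ 1 / 2)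
    (hxp : ∀ᶠ n in atTop, 1 - x n ≤ (1 - p n) + p n * (1 - p n) ^ (n - 1))
    (hmx : ∀ᶠ n : ℕ in atTop, m n * x n ≤ log n + ω n)
    (hmx2 : Tendsto (fun n => m n * x n ^ 2) atTop (𝓝 0))
    (hmp2 : Tendsto (fun n => m n * p n ^ 2) atTop (𝓝 0)) (hω : Tendsto ω atTop atBot) :
    Tendsto (fun n => rigProb n (m n) (p n) {G | G.Connected}) atTop (𝓝 0) := by
  have hlim : Tendsto (fun n => exp (ω n + 2 * (m n * x n ^ 2)) +
      (exp (8 * (m n * p n ^ 2)) - 1)) atTop (𝓝 0) := by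
    have h1 := tendsto_exp_atBot.comp (hω.atBot_add (hmx2.const_mul 2))
    have h2 := ((continuous_exp.tendsto _).comp (hmp2.const_mul 8)).sub_const 1
    simpa using h1.add h2
  refine squeeze_zero' ?_ ?_ hlim
  · filter_upwards [hp] with n hpn using rigProb_nonneg hpn.1 (by linarith [hpn.2]) _
  · filter_upwards [hp, hx, hxp, hmx, eventually_ge_atTop 2] with n hp hx hxp hmx hn
    refine (rigProb_connected_le hp.1 hp.2 hn).trans (add_le_add_left ?_ _)
    have hn' : (0 : ℝ) < n := by exact_mod_cast (by omega : 0 < n)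
    have hpow : exp (-(m n * x n + 2 * (m n * x n ^ 2))) ≤
        ((1 - p n) + p n * (1 - p n) ^ (n - 1)) ^ m n := by
      rw [show -(m n * x n + 2 * (m n * x n ^ 2)) = m n * (-(x n + 2 * x n ^ 2)) by ring,
        exp_nat_mul]
      exact pow_le_pow_left₀ (exp_pos _).le ((exp_neg_le_one_sub hx.2).trans hxp) _
    have hge : exp (-(ω n + 2 * (m n * x n ^ 2))) ≤
        n * ((1 - p n) + p n * (1 - p n) ^ (n - 1)) ^ m n := by
      refine le_trans ?_ (mul_le_mul_of_nonneg_left hpow hn'.le)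
      calc _ ≤ exp (log n + -(m n * x n + 2 * (m n * x n ^ 2))) := exp_le_exp.2 (by linarith)
        _ = _ := by rw [exp_add, exp_log hn']
    rw [← neg_neg (ω n + _), exp_neg, one_div]
    exact inv_anti₀ (exp_pos _) hge

end Asymptotics

section Regimes

open Real Topology

variable {α : ℝ} {ω : ℕ → ℝ} {m : ℕ → ℕ} {p : ℕ → ℝ}

lemma eventually_log_add_bounds (h : Tendsto (fun n => ω n / log n) atTop (𝓝 0)) :
    ∀ᶠ n : ℕ in atTop, 0 ≤ log n + ω n ∧ log n + ω n ≤ 2 * log n := by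
  have hlog : Tendsto (fun n : ℕ => log n) atTop atTop :=
    tendsto_log_atTop.comp tendsto_natCast_atTop_atTop
  filter_upwards [h.eventually_le_const (by norm_num : (0 : ℝ) < 1),
    h.eventually_const_le (by norm_num : (-1 : ℝ) < 0), hlog.eventually_gt_atTop 0]
    with n h1 h2 h3
  rw [div_le_iff₀ h3] at h1
  rw [le_div_iff₀ h3] at h2
  constructor <;> linarith

lemma eventually_half_rpow_le (hα : 0 < α) (hm : ∀ n, m n = ⌊(n : ℝ) ^ α⌋₊) :
    ∀ᶠ n : ℕ in atTop, (n : ℝ) ^ α / 2 ≤ m n := by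
  have h : Tendsto (fun n : ℕ => (n : ℝ) ^ α) atTop atTop :=
    (tendsto_rpow_atTop hα).comp tendsto_natCast_atTop_atTop
  filter_upwards [h.eventually_ge_atTop 2] with n hn
  have := Nat.lt_floor_add_one ((n : ℝ) ^ α)
  rw [hm]
  linarith

lemma tendsto_rigProb_one_of_not_connected_zero
    (h : Tendsto (fun n => rigProb n (m n) (p n) {G | ¬ G.Connected}) atTop (𝓝 0)) :
    Tendsto (fun n => rigProb n (m n) (p n) {G | G.Connected}) atTop (𝓝 1) := by
  have := h.const_sub 1
  rw [sub_zero] at this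
  exact this.congr fun n => by rw [rigProb_not_connected]; ring

lemma tendsto_rigProb_not_connected_one
    (h : Tendsto (fun n => rigProb n (m n) (p n) {G | G.Connected}) atTop (𝓝 0)) :
    Tendsto (fun n => rigProb n (m n) (p n) {G | ¬ G.Connected}) atTop (𝓝 1) := by
  have := h.const_sub 1
  rw [sub_zero] at this
  exact this.congr fun n => by rw [rigProb_not_connected]

theorem connectivity_threshold_of_le_one (hα : 0 < α) (hα1 : α ≤ 1)
    (hωsmall : Tendsto (fun n => ω n / log n) atTop (𝓝 0))
    (hm : ∀ n, m n = ⌊(n : ℝ) ^ α⌋₊) (hp : ∀ n : ℕ, p n = (log n + ω n) / m n) :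
    (Tendsto ω atTop atBot →
      Tendsto (fun n => rigProb n (m n) (p n) {G | ¬ G.Connected}) atTop (𝓝 1)) ∧
    (Tendsto ω atTop atTop →
      Tendsto (fun n => rigProb n (m n) (p n) {G | G.Connected}) atTop (𝓝 1)) := by
  have hL := eventually_log_add_bounds hωsmall
  have hmlow := eventually_half_rpow_le hα hm
  have hmpos : ∀ᶠ n in atTop, (0 : ℝ) < m n := by
    filter_upwards [hmlow, eventually_gt_atTop 0] with n h hn
    have hn' : (0 : ℝ) < n := by exact_mod_cast hn
    exact lt_of_lt_of_le (by positivity) h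
  have hpb : ∀ᶠ n in atTop, 0 ≤ p n ∧ p n ≤ 1 / 2 := by
    have h := tendsto_pow_div_zero_of_le_log hα 1 hL hmlow
    filter_upwards [hL, h.eventually_le_const (by norm_num : (0 : ℝ) < 1 / 2)] with n hLn hn
    rw [hp]
    rw [pow_one] at hn
    exact ⟨div_nonneg hLn.1 (Nat.cast_nonneg _), hn⟩
  have hmp : ∀ᶠ n : ℕ in atTop, m n * p n = log n + ω n := by
    filter_upwards [hmpos] with n hn
    rw [hp]; field_simp
  constructor
  · intro hω
    have hmp2 : Tendsto (fun n => m n * p n ^ 2) atTop (𝓝 0) := by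
      refine (tendsto_pow_div_zero_of_le_log hα 2 hL hmlow).congr' ?_
      filter_upwards [hmpos] with n hn
      rw [hp]; field_simp
    refine tendsto_rigProb_not_connected_one (tendsto_rigProb_connected_zero hpb hpb ?_
      (hmp.mono fun n h => h.le) hmp2 hmp2 hω)
    filter_upwards [hpb] with n hn
    have := mul_nonneg hn.1 (pow_nonneg (by linarith [hn.2] : 0 ≤ 1 - p n) (n - 1))
    linarith
  · intro hω
    have hmn : ∀ᶠ n in atTop, m n ≤ n := by
      filter_upwards [eventually_ge_atTop 1] with n hn
      have hn' : (1 : ℝ) ≤ n := by exact_mod_cast hn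
      rw [hm]
      refine Nat.floor_le_of_le ?_
      simpa using rpow_le_rpow_of_exponent_le hn' hα1
    have hmtop : Tendsto m atTop atTop := by
      rw [show m = fun n : ℕ => ⌊(n : ℝ) ^ α⌋₊ from funext hm]
      exact tendsto_nat_floor_atTop.comp
        ((tendsto_rpow_atTop hα).comp tendsto_natCast_atTop_atTop)
    have hcut : Tendsto (fun n => cutBound (m n) n (p n)) atTop (𝓝 0) := by
      refine tendsto_cutBound (w := fun n => ω n - 1) (2 / α) hmtop hmn
        (hpb.mono fun n h => ⟨h.1, by linarith [h.2]⟩) ?_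
        (tendsto_atTop_add_const_right _ (-1) hω) ?_
      · filter_upwards [hmn, hmp, hmpos, hL] with n hmn hmp hmpos hL
        have hmn' : (m n : ℝ) ≤ n := by exact_mod_cast hmn
        have hlog : log (m n) ≤ log n := log_le_log hmpos hmn'
        have h1 : (log (m n) + (ω n - 1)) * (1 + (log n + ω n)) ≤
            (log n + ω n - 1) * (1 + (log n + ω n)) :=
          mul_le_mul_of_nonneg_right (by linarith) (by linarith [hL.1])
        have h2 : (log n + ω n) ^ 2 ≤ n * m n * p n ^ 2 := by
          rw [← hmp, mul_pow, sq (m n : ℝ)]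
          gcongr
        rw [hmp]
        linarith
      · filter_upwards [hmp, hmlow, hL, eventually_gt_atTop 0] with n hmp hmlow hL hn
        have hn' : (0 : ℝ) < n := by exact_mod_cast hn
        have h := log_le_log (by positivity) hmlow
        rw [log_div (by positivity) (by norm_num), log_rpow hn'] at h
        have h2 : log 2 ≤ 1 := by linarith [log_two_lt_d9]
        rw [hmp, div_mul_eq_mul_div, le_div_iff₀ hα]
        nlinarith [hL.2]
    have hlim : Tendsto (fun n => exp (-ω n) + cutBound (m n) n (p n)) atTop (𝓝 0) := by
      simpa using (tendsto_exp_atBot.comp (tendsto_neg_atTop_atBot.comp hω)).add hcut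
    refine tendsto_rigProb_one_of_not_connected_zero (squeeze_zero' ?_ ?_ hlim)
    · filter_upwards [hpb] with n hpn using rigProb_nonneg hpn.1 (by linarith [hpn.2]) _
    · filter_upwards [hpb, hmp, eventually_gt_atTop 0] with n hpb hmp hn
      have hn' : (0 : ℝ) < n := by exact_mod_cast hn
      refine (rigProb_not_connected_le_feature_cut hpb.1 (by linarith [hpb.2]) hn).trans
        (add_le_add_left ?_ _)
      calc n * (1 - p n) ^ m n ≤ n * exp (-p n) ^ m n := by
            gcongr
            · linarith [hpb.2]
            · linarith [add_one_le_exp (-p n)]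
        _ = exp (-ω n) := by
            rw [← exp_nat_mul, mul_neg, hmp]
            nth_rewrite 1 [← exp_log hn']
            rw [← exp_add]
            ring_nf

theorem connectivity_threshold_of_one_lt (hα1 : 1 < α)
    (hωsmall : Tendsto (fun n => ω n / log n) atTop (𝓝 0))
    (hm : ∀ n, m n = ⌊(n : ℝ) ^ α⌋₊)
    (hp : ∀ n : ℕ, p n = √((log n + ω n) / (n * m n))) :
    (Tendsto ω atTop atBot →
      Tendsto (fun n => rigProb n (m n) (p n) {G | ¬ G.Connected}) atTop (𝓝 1)) ∧
    (Tendsto ω atTop atTop →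
      Tendsto (fun n => rigProb n (m n) (p n) {G | G.Connected}) atTop (𝓝 1)) := by
  have hα : 0 < α := by linarith
  have hL := eventually_log_add_bounds hωsmall
  have hmlow := eventually_half_rpow_le hα hm
  have hnpos : ∀ᶠ n : ℕ in atTop, (0 : ℝ) < n := by
    filter_upwards [eventually_gt_atTop 0] with n hn
    exact_mod_cast hn
  have hmpos : ∀ᶠ n in atTop, (0 : ℝ) < m n := by
    filter_upwards [hmlow, hnpos] with n h hn
    exact lt_of_lt_of_le (by positivity) h
  have hnlow : ∀ᶠ n : ℕ in atTop, (n : ℝ) ^ (1 : ℝ) / 2 ≤ n := by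
    filter_upwards [hnpos] with n hn
    rw [rpow_one]; linarith
  have hratio : ∀ᶠ n : ℕ in atTop, (n : ℝ) ^ (α - 1) / 2 ≤ m n / n := by
    filter_upwards [hmlow, hnpos] with n h hn
    rw [rpow_sub hn, rpow_one, div_right_comm]
    gcongr
  have hp0 : ∀ n, 0 ≤ p n := fun n => by rw [hp]; exact sqrt_nonneg _
  have hp2 : ∀ᶠ n : ℕ in atTop, p n ^ 2 = (log n + ω n) / (n * m n) := by
    filter_upwards [hL] with n hLn
    rw [hp, sq_sqrt (div_nonneg hLn.1 (by positivity))]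
  have hp2n : ∀ᶠ n : ℕ in atTop, n * p n ^ 2 = (log n + ω n) / m n := by
    filter_upwards [hp2, hnpos, hmpos] with n h hn hm
    rw [h]; field_simp
  have hp2mn : ∀ᶠ n : ℕ in atTop, m n * n * p n ^ 2 = log n + ω n := by
    filter_upwards [hp2, hnpos, hmpos] with n h hn hm
    rw [h]; field_simp
  have hLm := tendsto_pow_div_zero_of_le_log hα 1 hL hmlow
  simp only [pow_one] at hLm
  have hxb : ∀ᶠ n : ℕ in atTop, 0 ≤ n * p n ^ 2 ∧ n * p n ^ 2 ≤ 1 / 4 := by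
    filter_upwards [hLm.eventually_le_const (by norm_num : (0 : ℝ) < 1 / 4), hp2n] with n h h2
    exact ⟨by positivity, by rwa [h2]⟩
  have hpb : ∀ᶠ n in atTop, 0 ≤ p n ∧ p n ≤ 1 / 2 := by
    filter_upwards [hxb, eventually_ge_atTop 1] with n hx hn
    have hn' : (1 : ℝ) ≤ n := by exact_mod_cast hn
    refine ⟨hp0 n, ?_⟩
    have := mul_le_mul_of_nonneg_right hn' (sq_nonneg (p n))
    refine abs_le_of_sq_le_sq' (a := p n) ?_ (by norm_num) |>.2
    linarith [hx.2]
  constructor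
  · intro hω
    refine tendsto_rigProb_not_connected_one (tendsto_rigProb_connected_zero
      (x := fun n => n * p n ^ 2) hpb (hxb.mono fun n h => ⟨h.1, by linarith [h.2]⟩) ?_ ?_ ?_ ?_
      hω)
    · filter_upwards [hpb, eventually_ge_atTop 1] with n hpb hn
      have hb := one_add_mul_le_pow (a := -p n) (by linarith [hpb.2]) (n - 1)
      rw [Nat.cast_sub hn, Nat.cast_one, ← sub_eq_add_neg] at hb
      nlinarith [mul_le_mul_of_nonneg_left hb hpb.1, sq_nonneg (p n)]
    · filter_upwards [hp2mn] with n h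
      linarith
    · refine (tendsto_pow_div_zero_of_le_log hα 2 hL hmlow).congr' ?_
      filter_upwards [hp2n, hmpos] with n h hm
      rw [h]; field_simp
    · have h := tendsto_pow_div_zero_of_le_log one_pos 1 hL hnlow
      refine h.congr' ?_
      filter_upwards [hp2, hmpos, hnpos] with n h hm hn
      rw [h]; field_simp
  · intro hω
    have hnm : ∀ᶠ n in atTop, n ≤ m n := by
      filter_upwards [eventually_ge_atTop 1] with n hn
      have hn' : (1 : ℝ) ≤ n := by exact_mod_cast hn
      rw [hm]
      refine Nat.le_floor ?_
      simpa using rpow_le_rpow_of_exponent_le hn' hα1.le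
    have hnp : ∀ᶠ n : ℕ in atTop, n * p n ≤ 1 := by
      have h := tendsto_pow_div_zero_of_le_log (by linarith : 0 < α - 1) 1 hL hratio
      filter_upwards [h.eventually_le_const one_pos, hp2, hnpos, hmpos] with n h hp2 hn hm
      refine (abs_le_of_sq_le_sq' (b := 1) ?_ zero_le_one).2
      refine le_trans (le_of_eq ?_) (h.trans_eq (one_pow 2).symm)
      rw [mul_pow, hp2]; field_simp
    have hLnp : ∀ᶠ n : ℕ in atTop, (log n + ω n) * (n * p n) ≤ 1 := by
      have h := tendsto_pow_div_zero_of_le_log (by linarith : 0 < α - 1) 3 hL hratio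
      filter_upwards [h.eventually_le_const one_pos, hp2, hnpos, hmpos] with n h hp2 hn hm
      refine (abs_le_of_sq_le_sq' (b := 1) ?_ zero_le_one).2
      refine le_trans (le_of_eq ?_) (h.trans_eq (one_pow 2).symm)
      rw [mul_pow, mul_pow, hp2]; field_simp
    have hcut : Tendsto (fun n => cutBound n (m n) (p n)) atTop (𝓝 0) := by
      refine tendsto_cutBound (N := fun n => n) (w := fun n => ω n - 1) 1 tendsto_id hnm
        (hpb.mono fun n h => ⟨h.1, by linarith [h.2]⟩) ?_
        (tendsto_atTop_add_const_right _ (-1) hω) ?_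
      · filter_upwards [hp2mn, hLnp, hpb] with n h1 h2 h3
        have := mul_nonneg (Nat.cast_nonneg n : (0 : ℝ) ≤ n) h3.1
        rw [h1]
        linarith
      · filter_upwards [hnp] with n h
        linarith [log_natCast_nonneg n]
    refine tendsto_rigProb_one_of_not_connected_zero (squeeze_zero' ?_ ?_ hcut)
    · filter_upwards [hpb] with n hpn using rigProb_nonneg hpn.1 (by linarith [hpn.2]) _
    · filter_upwards [hpb, eventually_gt_atTop 0] with n hpb hn
      exact rigProb_not_connected_le_vertex_cut hpb.1 (by linarith [hpb.2]) hn

end Regimes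

/-- Sharp threshold for connectivity of the random intersection graph `G(n, m, p₁)`
with `m = ⌊n^α⌋` and `p₁` as in Theorem 3 (Rybarczyk): if `ω → -∞` then whp the graph
is disconnected, and if `ω → ∞` then whp it is connected. -/
theorem rig_connectivity_threshold
    (α : ℝ) (hα : 0 < α) (ω : ℕ → ℝ)
    (hωsmall : Tendsto (fun n => ω n / Real.log n) atTop (nhds 0))
    (m : ℕ → ℕ) (hm : ∀ n, m n = ⌊(n : ℝ) ^ α⌋₊)
    (p₁ : ℕ → ℝ)
    (hp : ∀ n, p₁ n =
      if α ≤ 1 then (Real.log n + ω n) / (m n)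
      else Real.sqrt ((Real.log n + ω n) / ((n : ℝ) * (m n)))) :
    (Tendsto ω atTop atBot →
      Tendsto (fun n => rigProb n (m n) (p₁ n) {G | ¬ G.Connected}) atTop (nhds 1)) ∧
    (Tendsto ω atTop atTop →
      Tendsto (fun n => rigProb n (m n) (p₁ n) {G | G.Connected}) atTop (nhds 1)) := by
  by_cases hα1 : α ≤ 1
  · exact connectivity_threshold_of_le_one hα hα1 hωsmall hm fun n => by rw [hp, if_pos hα1]
  · exact connectivity_threshold_of_one_lt (not_le.1 hα1) hωsmall hm fun n => by
      rw [hp, if_neg hα1]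
end
end

section
/- Let A be an increasing property of graphs on a vertex set of size n, let p = p(n) and m = m(n) satisfy m·p² < 1 and n·p = o(1), and set p̂₋ = m·p²·(1 − (n−2)·p − m·p²/2). If the probability that the Erdős–Rényi random graph G(n,p̂₋) has property A tends to 1 as n → ∞, then the probability that the random intersection graph G(n,m,p) has property A also tends to 1 as n → ∞. -/
open scoped Classical
open Filter

noncomputable section

/-- The probability of the graph `G` under the Erdős–Rényi model `G(n, q)`, in which
each of the `n.choose 2` possible edges appears independently with probability `q`. -/
def erDist (n : ℕ) (q : ℝ) (G : SimpleGraph (Fin n)) : ℝ :=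
  q ^ G.edgeSet.ncard * (1 - q) ^ (n.choose 2 - G.edgeSet.ncard)

/-- The probability that the Erdős–Rényi random graph `G(n, q)` lies in the set `A`. -/
def erProb (n : ℕ) (q : ℝ) (A : Set (SimpleGraph (Fin n))) : ℝ :=
  ∑ G : SimpleGraph (Fin n), if G ∈ A then erDist n q G else 0

/-- The expectation of `φ` over `j` independent samples from the weight function `ρ`. -/
def seqExp {α : Type*} [Fintype α] (ρ : α → ℝ) (j : ℕ) (φ : (Fin j → α) → ℝ) : ℝ :=
  ∑ ω : Fin j → α, (∏ i, ρ (ω i)) * φ ω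

/-- The elements of `B` occurring in the sequence `ω`. -/
def hits {α : Type*} (B : Finset α) {j : ℕ} (ω : Fin j → α) : Finset α :=
  B.filter (fun b => ∃ i, ω i = b)

section Sampling

variable {α : Type*} {ρ : α → ℝ} {B : Finset α}

lemma mem_hits {j : ℕ} {ω : Fin j → α} {b : α} : b ∈ hits B ω ↔ b ∈ B ∧ ∃ i, ω i = b :=
  Finset.mem_filter

lemma hits_subset {j : ℕ} (ω : Fin j → α) : hits B ω ⊆ B := Finset.filter_subset _ _

lemma hits_subset_iff {j : ℕ} (ω : Fin j → α) (S : Finset α) :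
    hits B ω ⊆ S ↔ ∀ i, ω i ∈ B → ω i ∈ S := by
  simp only [Finset.subset_iff, mem_hits]
  grind

lemma hits_subset_hits_insertNth {j : ℕ} (i : Fin (j + 1)) (a : α) (ω : Fin j → α) :
    hits B ω ⊆ hits B (i.insertNth (α := fun _ => α) a ω) := by
  intro b
  simp only [mem_hits, Fin.exists_iff_succAbove i, Fin.insertNth_apply_same,
    Fin.insertNth_apply_succAbove]
  tauto

lemma hits_insertNth_of_notMem {j : ℕ} (i : Fin (j + 1)) {a : α} (ha : a ∉ B) (ω : Fin j → α) :
    hits B (i.insertNth (α := fun _ => α) a ω) = hits B ω := by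
  ext b
  simp only [mem_hits, Fin.exists_iff_succAbove i, Fin.insertNth_apply_same,
    Fin.insertNth_apply_succAbove]
  grind

variable [Fintype α]

lemma seqExp_zero (φ : (Fin 0 → α) → ℝ) : seqExp ρ 0 φ = φ Fin.elim0 := by
  simp only [seqExp, Finset.univ_unique, Finset.univ_eq_empty, Finset.prod_empty, one_mul,
    Finset.sum_singleton]
  congr 1

lemma seqExp_succ {j : ℕ} (i : Fin (j + 1)) (φ : (Fin (j + 1) → α) → ℝ) :
    seqExp ρ (j + 1) φ =
      ∑ a, ρ a * seqExp ρ j (fun ω => φ (i.insertNth (α := fun _ => α) a ω)) := by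
  unfold seqExp
  rw [← (Fin.insertNthEquiv (fun _ => α) i).sum_comp, Fintype.sum_prod_type]
  simp [Fin.prod_univ_succAbove _ i, Finset.mul_sum, mul_assoc, Fin.insertNthEquiv]

lemma seqExp_const_mul {j : ℕ} (c : ℝ) (φ : (Fin j → α) → ℝ) :
    seqExp ρ j (fun ω => c * φ ω) = c * seqExp ρ j φ := by
  simp only [seqExp, Finset.mul_sum]
  exact Finset.sum_congr rfl fun _ _ => by ring

lemma seqExp_add {j : ℕ} (φ ψ : (Fin j → α) → ℝ) :
    seqExp ρ j (fun ω => φ ω + ψ ω) = seqExp ρ j φ + seqExp ρ j ψ := by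
  simp only [seqExp, mul_add, Finset.sum_add_distrib]

lemma seqExp_sum {ι : Type*} {j : ℕ} (s : Finset ι) (φ : ι → (Fin j → α) → ℝ) :
    seqExp ρ j (fun ω => ∑ i ∈ s, φ i ω) = ∑ i ∈ s, seqExp ρ j (φ i) := by
  simp only [seqExp, Finset.mul_sum]
  exact Finset.sum_comm

lemma seqExp_mono (hρ : ∀ a, 0 ≤ ρ a) {j : ℕ} {φ ψ : (Fin j → α) → ℝ} (h : ∀ ω, φ ω ≤ ψ ω) :
    seqExp ρ j φ ≤ seqExp ρ j ψ :=
  Finset.sum_le_sum fun ω _ =>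
    mul_le_mul_of_nonneg_left (h ω) (Finset.prod_nonneg fun _ _ => hρ _)

lemma seqExp_const (hsum : ∑ a, ρ a = 1) (j : ℕ) (c : ℝ) :
    seqExp ρ j (fun _ => c) = c := by
  induction j with
  | zero => rw [seqExp_zero]
  | succ j ih => rw [seqExp_succ 0]; simp only [ih, ← Finset.sum_mul, hsum, one_mul]

lemma seqExp_sum_centered (hsum : ∑ a, ρ a = 1) {y : α → ℝ} (hy : ∑ a, ρ a * y a = 0) (j : ℕ) :
    seqExp ρ j (fun ω => ∑ i, y (ω i)) = 0 := by
  induction j with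
  | zero => rw [seqExp_zero]; simp
  | succ j ih =>
    rw [seqExp_succ 0]
    simp only [Fin.sum_univ_succAbove _ (0 : Fin (j + 1)), Fin.insertNth_apply_same,
      Fin.insertNth_apply_succAbove, seqExp_add, ih, seqExp_const hsum, add_zero, hy]

lemma seqExp_sq_sum_centered (hsum : ∑ a, ρ a = 1) {y : α → ℝ} (hy : ∑ a, ρ a * y a = 0)
    (j : ℕ) :
    seqExp ρ j (fun ω => (∑ i, y (ω i)) ^ 2) = j * ∑ a, ρ a * y a ^ 2 := by
  induction j with
  | zero => rw [seqExp_zero]; simp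
  | succ j ih =>
    rw [seqExp_succ 0]
    simp only [Fin.sum_univ_succAbove _ (0 : Fin (j + 1)), Fin.insertNth_apply_same,
      Fin.insertNth_apply_succAbove, add_sq, seqExp_add, ih, seqExp_const hsum, seqExp_const_mul,
      seqExp_sum_centered hsum hy, mul_zero, add_zero, mul_add, Finset.sum_add_distrib,
      ← Finset.sum_mul, hsum]
    push_cast
    ring

lemma seqExp_sq_le (hρ : ∀ a, 0 ≤ ρ a) (hsum : ∑ a, ρ a = 1) {j : ℕ} (φ : (Fin j → α) → ℝ) :
    seqExp ρ j φ ^ 2 ≤ seqExp ρ j (fun ω => φ ω ^ 2) := by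
  have h1 : ∑ ω : Fin j → α, ∏ i, ρ (ω i) = 1 := by
    simpa [seqExp] using seqExp_const hsum j 1
  have hw (ω : Fin j → α) : 0 ≤ ∏ i, ρ (ω i) := Finset.prod_nonneg fun _ _ => hρ _
  have := Finset.sum_sq_le_sum_mul_sum_of_sq_le_mul Finset.univ
    (r := fun ω : Fin j → α => (∏ i, ρ (ω i)) * φ ω) (f := fun ω => ∏ i, ρ (ω i))
    (g := fun ω => (∏ i, ρ (ω i)) * φ ω ^ 2)
    (fun ω _ => hw ω) (fun ω _ => mul_nonneg (hw ω) (sq_nonneg _))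
    (fun ω _ => le_of_eq (by ring))
  rwa [h1, one_mul] at this

/-- The probability that the set of elements of `B` hit by `j` samples satisfies `P`. -/
def hitProb (ρ : α → ℝ) (B : Finset α) (P : Finset α → Prop) (j : ℕ) : ℝ :=
  seqExp ρ j (fun ω => if P (hits B ω) then 1 else 0)

lemma sum_notMem (hsum : ∑ a, ρ a = 1) {r : ℝ} (hB : ∀ b ∈ B, ρ b = r) :
    ∑ a, ρ a * (if a ∈ B then 0 else 1) = 1 - B.card * r := by
  have h : ∑ a ∈ B, ρ a = B.card * r := by rw [Finset.sum_congr rfl hB]; simp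
  have h2 : ∑ a, ρ a * (if a ∈ B then (0 : ℝ) else 1) + ∑ a ∈ B, ρ a = 1 := by
    refine Eq.trans ?_ hsum
    rw [← Finset.sum_filter_add_sum_filter_not Finset.univ (· ∈ B) ρ, add_comm]
    simp [Finset.sum_ite]
  linarith

lemma hitProb_le_succ (hρ : ∀ a, 0 ≤ ρ a) (hsum : ∑ a, ρ a = 1) {P : Finset α → Prop}
    (hP : ∀ S T, S ⊆ T → P S → P T) (j : ℕ) :
    hitProb ρ B P j ≤ hitProb ρ B P (j + 1) := by
  unfold hitProb
  rw [seqExp_succ 0]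
  calc _ = ∑ a, ρ a * seqExp ρ j (fun ω => if P (hits B ω) then 1 else 0) := by
        rw [← Finset.sum_mul, hsum, one_mul]
    _ ≤ _ := by
        refine Finset.sum_le_sum fun a _ => mul_le_mul_of_nonneg_left ?_ (hρ a)
        refine seqExp_mono hρ fun ω => ?_
        have := hP _ _ (hits_subset_hits_insertNth (B := B) 0 a ω)
        split_ifs with h h' <;> first | exact absurd (this h) h' | norm_num

lemma seqExp_hit_mul_notMem (hsum : ∑ a, ρ a = 1) {r : ℝ} (hB : ∀ b ∈ B, ρ b = r)
    (P : Finset α → Prop) {j : ℕ} (i : Fin (j + 1)) :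
    seqExp ρ (j + 1) (fun ω => (if P (hits B ω) then 1 else 0) * (if ω i ∈ B then 0 else 1)) =
      (1 - B.card * r) * hitProb ρ B P j := by
  rw [seqExp_succ i, ← sum_notMem hsum hB, Finset.sum_mul]
  refine Finset.sum_congr rfl fun a _ => ?_
  rw [mul_assoc]
  congr 1
  simp only [Fin.insertNth_apply_same]
  by_cases ha : a ∈ B
  · simp [ha, seqExp]
  · simp [ha, hits_insertNth_of_notMem i ha, hitProb]

lemma mul_sq_hitProb_succ_sub_le (hρ : ∀ a, 0 ≤ ρ a) (hsum : ∑ a, ρ a = 1) {r : ℝ}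
    (hB : ∀ b ∈ B, ρ b = r) (hq : B.card * r < 1) (P : Finset α → Prop) (j : ℕ) :
    (j + 1) * (hitProb ρ B P (j + 1) - hitProb ρ B P j) ^ 2 ≤
      B.card * r / (1 - B.card * r) := by
  set q : ℝ := B.card * r with hqdef
  have hq' : 0 < 1 - q := by linarith
  set z : α → ℝ := fun a => if a ∈ B then 0 else 1 with hz
  have hzsum : ∑ a, ρ a * z a = 1 - q := sum_notMem hsum hB
  have hzsq (a) : z a ^ 2 = z a := by simp only [hz]; split_ifs <;> norm_num
  set y : α → ℝ := fun a => 1 + (-(1 - q)⁻¹) * z a with hy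
  have hy0 : ∑ a, ρ a * y a = 0 := by
    have : ∀ a, ρ a * y a = ρ a + (-(1 - q)⁻¹) * (ρ a * z a) := fun a => by simp only [hy]; ring
    simp only [this, Finset.sum_add_distrib, ← Finset.mul_sum, hsum, hzsum]
    field_simp
    ring
  have hy2 : ∑ a, ρ a * y a ^ 2 = q / (1 - q) := by
    have : ∀ a, ρ a * y a ^ 2 =
        ρ a + (-2 * (1 - q)⁻¹ + (1 - q)⁻¹ ^ 2) * (ρ a * z a) := fun a => by
      simp only [hy]; linear_combination ((1 - q)⁻¹ ^ 2) * ρ a * hzsq a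
    simp only [this, Finset.sum_add_distrib, ← Finset.mul_sum, hsum, hzsum]
    field_simp
    ring
  have hmean : seqExp ρ (j + 1) (fun ω => (if P (hits B ω) then 1 else 0) * ∑ i, y (ω i)) =
      (j + 1) * (hitProb ρ B P (j + 1) - hitProb ρ B P j) := by
    have hi (i : Fin (j + 1)) :
        seqExp ρ (j + 1) (fun ω => (if P (hits B ω) then 1 else 0) * y (ω i)) =
          hitProb ρ B P (j + 1) - hitProb ρ B P j := by
      have : ∀ ω : Fin (j + 1) → α, (if P (hits B ω) then (1 : ℝ) else 0) * y (ω i) =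
          (if P (hits B ω) then 1 else 0) +
            (-(1 - q)⁻¹) * ((if P (hits B ω) then 1 else 0) * z (ω i)) := fun ω => by
        simp only [hy]; ring
      simp only [this, seqExp_add, seqExp_const_mul]
      rw [seqExp_hit_mul_notMem hsum hB]
      change hitProb ρ B P (j + 1) + _ = _
      rw [← hqdef]
      field_simp
      ring
    simp only [Finset.mul_sum]
    rw [seqExp_sum, Finset.sum_congr rfl fun i _ => hi i]
    simp [mul_sub]
  have hsq := seqExp_sq_le hρ hsum (j := j + 1)
    (fun ω => (if P (hits B ω) then 1 else 0) * ∑ i, y (ω i))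
  rw [hmean] at hsq
  have hvar : seqExp ρ (j + 1)
      (fun ω => ((if P (hits B ω) then 1 else 0) * ∑ i, y (ω i)) ^ 2) ≤
      (j + 1) * (q / (1 - q)) := by
    have := seqExp_sq_sum_centered hsum hy0 (j + 1)
    rw [hy2] at this
    push_cast at this
    rw [← this]
    refine seqExp_mono hρ fun ω => ?_
    split_ifs
    · simp
    · simpa using sq_nonneg _
  have hj : (0 : ℝ) < j + 1 := by positivity
  refine le_of_mul_le_mul_left (le_trans (le_of_eq ?_) (hsq.trans hvar)) hj
  ring

lemma hitProb_add_le (hρ : ∀ a, 0 ≤ ρ a) (hsum : ∑ a, ρ a = 1) {r : ℝ}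
    (hB : ∀ b ∈ B, ρ b = r) (hq : B.card * r < 1) (P : Finset α → Prop) (m k : ℕ) :
    hitProb ρ B P (m + k) ≤
      hitProb ρ B P m + k * (√(B.card * r / (1 - B.card * r)) / √(m + 1)) := by
  induction k with
  | zero => simp
  | succ k ih =>
    have hr : 0 ≤ B.card * r := by
      rcases B.eq_empty_or_nonempty with rfl | ⟨b, hb⟩
      · simp
      · rw [← hB b hb]; exact mul_nonneg (Nat.cast_nonneg _) (hρ b)
    have hQ : 0 ≤ B.card * r / (1 - B.card * r) := div_nonneg hr (by linarith)
    have h := mul_sq_hitProb_succ_sub_le hρ hsum hB hq P (m + k)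
    have hstep : hitProb ρ B P (m + k + 1) - hitProb ρ B P (m + k) ≤
        √(B.card * r / (1 - B.card * r)) / √(m + 1) := by
      rw [← Real.sqrt_div hQ]
      apply Real.le_sqrt_of_sq_le
      rw [le_div_iff₀ (by positivity), mul_comm]
      refine le_trans (mul_le_mul_of_nonneg_right ?_ (sq_nonneg _)) h
      push_cast
      linarith [(Nat.cast_nonneg k : (0 : ℝ) ≤ k)]
    rw [← add_assoc]
    push_cast
    linarith

lemma hitProb_le_add_sq (hρ : ∀ a, 0 ≤ ρ a) (hsum : ∑ a, ρ a = 1) {r : ℝ}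
    (hB : ∀ b ∈ B, ρ b = r) (hq : B.card * r < 1) {P : Finset α → Prop}
    (hP : ∀ S T, S ⊆ T → P S → P T) (m j : ℕ) {μ : ℝ} (hμ : μ ≤ m) :
    hitProb ρ B P j ≤ hitProb ρ B P m +
      √(B.card * r / (1 - B.card * r)) / 2 * (1 + (j - μ) ^ 2 / (m + 1)) := by
  have hs := Real.sqrt_nonneg (B.card * r / (1 - B.card * r))
  rcases le_total j m with hjm | hjm
  · have : hitProb ρ B P j ≤ hitProb ρ B P m :=
      monotone_nat_of_le_succ (hitProb_le_succ hρ hsum hP) hjm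
    have : 0 ≤ √(B.card * r / (1 - B.card * r)) / 2 * (1 + (j - μ) ^ 2 / (m + 1)) := by
      positivity
    linarith
  · obtain ⟨k, rfl⟩ := Nat.exists_eq_add_of_le hjm
    refine (hitProb_add_le hρ hsum hB hq P m k).trans ?_
    have hm : (0 : ℝ) < √(m + 1) := by positivity
    have hm2 : √((m : ℝ) + 1) ^ 2 = m + 1 := Real.sq_sqrt (by positivity)
    have hk : ((k : ℝ) / √(m + 1)) ^ 2 ≤ (((m + k : ℕ) : ℝ) - μ) ^ 2 / (m + 1) := by
      rw [div_pow, hm2]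
      gcongr
      push_cast
      linarith
    have : (k : ℝ) / √(m + 1) ≤ (1 + (((m + k : ℕ) : ℝ) - μ) ^ 2 / (m + 1)) / 2 := by
      nlinarith [sq_nonneg ((k : ℝ) / √(m + 1) - 1)]
    have := mul_le_mul_of_nonneg_left this hs
    calc _ = hitProb ρ B P m + √(B.card * r / (1 - B.card * r)) * (k / √(m + 1)) := by ring
      _ ≤ _ := by linarith

/-- The Poisson weights. -/
def poissonWeight (μ : ℝ) (j : ℕ) : ℝ := Real.exp (-μ) * (μ ^ j / j.factorial)

lemma poissonWeight_nonneg {μ : ℝ} (hμ : 0 ≤ μ) (j : ℕ) : 0 ≤ poissonWeight μ j := by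
  unfold poissonWeight; positivity

lemma hasSum_poissonWeight_mul_pow (μ c : ℝ) :
    HasSum (fun j => poissonWeight μ j * c ^ j) (Real.exp (-(μ * (1 - c)))) := by
  have h := (NormedSpace.expSeries_div_hasSum_exp (μ * c)).mul_left (Real.exp (-μ))
  rw [← Real.exp_eq_exp_ℝ, ← Real.exp_add] at h
  convert! h using 1
  · ext j; simp only [poissonWeight, mul_pow]; ring
  · congr 1; ring

lemma hasSum_poissonWeight (μ : ℝ) : HasSum (poissonWeight μ) 1 := by
  simpa using hasSum_poissonWeight_mul_pow μ 1

lemma poissonWeight_succ_mul (μ : ℝ) (j : ℕ) :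
    poissonWeight μ (j + 1) * ((j + 1 : ℕ) : ℝ) = μ * poissonWeight μ j := by
  simp only [poissonWeight, Nat.factorial_succ]
  have : (j.factorial : ℝ) ≠ 0 := by positivity
  push_cast
  field_simp
  ring

lemma hasSum_poissonWeight_mul_id (μ : ℝ) : HasSum (fun j => poissonWeight μ j * j) μ := by
  rw [← hasSum_nat_add_iff' 1]
  simpa only [poissonWeight_succ_mul, Finset.range_one, Finset.sum_singleton, Nat.cast_zero,
    mul_zero, sub_zero, mul_one] using (hasSum_poissonWeight μ).mul_left μ

lemma hasSum_poissonWeight_mul_sq (μ : ℝ) :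
    HasSum (fun j => poissonWeight μ j * (j : ℝ) ^ 2) (μ ^ 2 + μ) := by
  rw [← hasSum_nat_add_iff' 1]
  have h := ((hasSum_poissonWeight_mul_id μ).add (hasSum_poissonWeight μ)).mul_left μ
  convert! h using 1
  · ext j
    rw [sq, ← mul_assoc, poissonWeight_succ_mul]
    push_cast
    ring
  · simp; ring

lemma hasSum_poissonWeight_mul_sq_sub (μ : ℝ) :
    HasSum (fun j => poissonWeight μ j * ((j : ℝ) - μ) ^ 2) μ := by
  have h := ((hasSum_poissonWeight_mul_sq μ).add
    ((hasSum_poissonWeight_mul_id μ).mul_left (-2 * μ))).add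
    ((hasSum_poissonWeight μ).mul_left (μ ^ 2))
  convert! h using 1
  · ext j; ring
  · ring

lemma hitProb_subset (hsum : ∑ a, ρ a = 1) {r : ℝ} (hB : ∀ b ∈ B, ρ b = r)
    {S : Finset α} (hS : S ⊆ B) (j : ℕ) :
    hitProb ρ B (· ⊆ S) j = (1 - ((B.card : ℝ) - S.card) * r) ^ j := by
  have hone : ∑ a, ρ a * (if a ∈ B \ S then 0 else 1) = 1 - ((B.card : ℝ) - S.card) * r := by
    rw [sum_notMem hsum (B := B \ S) (r := r) fun b hb => hB b (Finset.mem_sdiff.1 hb).1,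
      Finset.card_sdiff_of_subset hS, Nat.cast_sub (Finset.card_le_card hS)]
  have hind : hitProb ρ B (· ⊆ S) j =
      seqExp ρ j (fun ω => if ∀ i, ω i ∈ B → ω i ∈ S then 1 else 0) := by
    unfold hitProb
    congr 1
    ext ω
    by_cases h : hits B ω ⊆ S
    · exact (if_pos h).trans (if_pos ((hits_subset_iff ω S).1 h)).symm
    · exact (if_neg h).trans (if_neg (mt (hits_subset_iff ω S).2 h)).symm
  rw [hind]
  clear hind
  induction j with
  | zero => rw [seqExp_zero]; simp
  | succ j ih =>
    rw [seqExp_succ 0, pow_succ', ← ih, ← hone, Finset.sum_mul]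
    refine Finset.sum_congr rfl fun a _ => ?_
    rw [mul_assoc]
    congr 1
    have hiff (ω : Fin j → α) : (∀ i, Fin.insertNth (α := fun _ => α) 0 a ω i ∈ B →
        Fin.insertNth (α := fun _ => α) 0 a ω i ∈ S) ↔
        (a ∈ B → a ∈ S) ∧ ∀ i, ω i ∈ B → ω i ∈ S := by
      rw [Fin.forall_iff_succAbove 0]
      simp only [Fin.insertNth_apply_same, Fin.insertNth_apply_succAbove]
    simp only [hiff]
    by_cases ha : a ∈ B \ S
    · have : ¬ (a ∈ B → a ∈ S) := by simpa using ha
      simp [ha, this, seqExp]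
    · have : (a ∈ B → a ∈ S) = True := eq_true (by simpa using ha)
      rw [if_neg ha, one_mul]
      simp only [this, true_and]

lemma hitProb_eq_sum {U : Finset α} (P : Finset α → Prop) (j : ℕ)
    (hPU : ∀ S ⊆ B, P S → S ⊆ U) :
    hitProb ρ B P j = ∑ T ∈ U.powerset, if P T then hitProb ρ B (· = T) j else 0 := by
  unfold hitProb
  rw [← Finset.sum_filter, ← seqExp_sum]
  congr 1
  ext ω
  have := hPU _ (hits_subset ω)
  have h := Finset.sum_ite_eq (U.powerset.filter P) (hits B ω) (fun _ => (1 : ℝ))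
  refine Eq.trans (if_congr ?_ rfl rfl)
    (h.symm.trans (Finset.sum_congr rfl fun _ _ => by congr))
  simp only [Finset.mem_filter, Finset.mem_powerset]
  tauto

lemma hasSum_hitProb_eq (hsum : ∑ a, ρ a = 1) {r : ℝ} (hB : ∀ b ∈ B, ρ b = r) (μ : ℝ)
    (T : Finset α) (hT : T ⊆ B) :
    HasSum (fun j => poissonWeight μ j * hitProb ρ B (· = T) j)
      ((1 - Real.exp (-(μ * r))) ^ T.card * Real.exp (-(μ * r)) ^ (B.card - T.card)) := by
  induction T using Finset.strongInduction with
  | H T ih =>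
  have hpow : ∀ S ⊆ B, Real.exp (-(μ * (1 - (1 - ((B.card : ℝ) - S.card) * r)))) =
      Real.exp (-(μ * r)) ^ (B.card - S.card) := fun S hS => by
    rw [← Real.exp_nat_mul, Nat.cast_sub (Finset.card_le_card hS)]
    congr 1
    ring
  have htot := hasSum_poissonWeight_mul_pow μ (1 - ((B.card : ℝ) - T.card) * r)
  rw [hpow T hT] at htot
  have hss := hasSum_sum (s := T.ssubsets) fun S hS =>
    ih S (Finset.mem_ssubsets.1 hS) ((Finset.mem_ssubsets.1 hS).1.trans hT)
  have hins : T.powerset = insert T T.ssubsets := by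
    ext S
    simp [Finset.ssubset_iff_subset_ne]
    grind
  have hnot : T ∉ T.ssubsets := by simp
  convert! htot.sub hss using 1
  · ext j
    rw [← hitProb_subset hsum hB hT, hitProb_eq_sum (U := T) (· ⊆ T) j (fun _ _ h => h),
      hins, Finset.sum_insert hnot, ← Finset.mul_sum, ← mul_sub, if_pos subset_rfl]
    congr 1
    rw [eq_sub_iff_add_eq]
    congr 1
    exact Finset.sum_congr rfl fun S hS => (if_pos (Finset.mem_ssubsets.1 hS).1).symm
  · rw [eq_sub_iff_add_eq, ← Finset.sum_insert (f := fun S : Finset α =>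
      (1 - Real.exp (-(μ * r))) ^ S.card * Real.exp (-(μ * r)) ^ (B.card - S.card)) hnot, ← hins]
    have h := Finset.sum_pow_mul_eq_add_pow (1 - Real.exp (-(μ * r))) (Real.exp (-(μ * r))) T
    rw [sub_add_cancel, one_pow] at h
    have h' := congrArg (Real.exp (-(μ * r)) ^ (B.card - T.card) * ·) h
    simp only [Finset.mul_sum, mul_one] at h'
    rw [← h']
    refine Finset.sum_congr rfl fun S hS => ?_
    have h1 := Finset.card_le_card (Finset.mem_powerset.1 hS)
    have h2 := Finset.card_le_card hT
    rw [show B.card - S.card = (B.card - T.card) + (T.card - S.card) by omega, pow_add]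
    ring

/-- Comparison of a random subset of `B` with independent elements and the set of elements of
`B` hit by `m` samples. -/
lemma sum_indep_le_hitProb (hρ : ∀ a, 0 ≤ ρ a) (hsum : ∑ a, ρ a = 1) {r : ℝ}
    (hB : ∀ b ∈ B, ρ b = r) (hq : B.card * r < 1) {P : Finset α → Prop}
    (hP : ∀ S T, S ⊆ T → P S → P T) (m : ℕ) {μ : ℝ} (hμ0 : 0 ≤ μ) (hμ : μ ≤ m) :
    (∑ T ∈ B.powerset, if P T then
      (1 - Real.exp (-(μ * r))) ^ T.card * Real.exp (-(μ * r)) ^ (B.card - T.card) else 0) ≤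
      hitProb ρ B P m + √(B.card * r / (1 - B.card * r)) := by
  have h1 : HasSum (fun j => poissonWeight μ j * hitProb ρ B P j)
      (∑ T ∈ B.powerset, if P T then
        (1 - Real.exp (-(μ * r))) ^ T.card * Real.exp (-(μ * r)) ^ (B.card - T.card) else 0) := by
    have h := hasSum_sum (s := B.powerset.filter P) fun T hT =>
      hasSum_hitProb_eq hsum hB μ T (Finset.mem_powerset.1 (Finset.mem_filter.1 hT).1)
    rw [Finset.sum_filter] at h
    convert! h using 1
    ext j
    rw [hitProb_eq_sum (U := B) P j fun _ h _ => h, ← Finset.sum_filter, Finset.mul_sum]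
  have h2 := ((hasSum_poissonWeight μ).mul_left (hitProb ρ B P m +
    √(B.card * r / (1 - B.card * r)) / 2)).add ((hasSum_poissonWeight_mul_sq_sub μ).mul_left
      (√(B.card * r / (1 - B.card * r)) / 2 / (m + 1)))
  refine (hasSum_le (fun j => ?_) h1 h2).trans ?_
  · refine (mul_le_mul_of_nonneg_left (hitProb_le_add_sq hρ hsum hB hq hP m j hμ)
      (poissonWeight_nonneg hμ0 j)).trans (le_of_eq ?_)
    ring
  · have hs := Real.sqrt_nonneg (B.card * r / (1 - B.card * r))
    have : μ / (m + 1) ≤ 1 := (div_le_one (by positivity)).2 (by linarith)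
    have := mul_le_mul_of_nonneg_left this hs
    calc _ = hitProb ρ B P m + √(B.card * r / (1 - B.card * r)) / 2 +
          √(B.card * r / (1 - B.card * r)) * (μ / (m + 1)) / 2 := by ring
      _ ≤ _ := by linarith

end Sampling

lemma prod_ite_mem_eq_pow_mul_pow {k : ℕ} (s : Finset (Fin k)) (p : ℝ) :
    ∏ i, (if i ∈ s then p else 1 - p) = p ^ s.card * (1 - p) ^ (k - s.card) := by
  rw [Finset.prod_ite]
  simp [Finset.filter_not, Finset.card_sdiff_of_subset]

/-- The probability that `V` is the set of vertices choosing a given feature. -/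
def featureWeight (n : ℕ) (p : ℝ) (V : Finset (Fin n)) : ℝ :=
  p ^ V.card * (1 - p) ^ (n - V.card)

lemma featureWeight_nonneg (n : ℕ) {p : ℝ} (h0 : 0 ≤ p) (h1 : p ≤ 1) (V : Finset (Fin n)) :
    0 ≤ featureWeight n p V :=
  mul_nonneg (pow_nonneg h0 _) (pow_nonneg (sub_nonneg.2 h1) _)

lemma sum_featureWeight (n : ℕ) (p : ℝ) : ∑ V, featureWeight n p V = 1 := by
  simpa [featureWeight] using Fintype.sum_pow_mul_eq_add_pow (Fin n) p (1 - p)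

/-- The feature assignment in which `ω i` is the set of vertices choosing the feature `i`. -/
def transposeAssign {n m : ℕ} (ω : Fin m → Finset (Fin n)) (v : Fin n) : Finset (Fin m) :=
  Finset.univ.filter (fun i => v ∈ ω i)

lemma mem_transposeAssign {n m : ℕ} (ω : Fin m → Finset (Fin n)) (v : Fin n) (i : Fin m) :
    i ∈ transposeAssign ω v ↔ v ∈ ω i := by
  simp [transposeAssign]

/-- Feature assignments, described by the features of each vertex or by the vertices of each
feature. -/
def transposeEquiv (n m : ℕ) : (Fin m → Finset (Fin n)) ≃ (Fin n → Finset (Fin m)) where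
  toFun := transposeAssign
  invFun := transposeAssign
  left_inv ω := by ext; simp [mem_transposeAssign]
  right_inv ω := by ext; simp [mem_transposeAssign]

lemma assignWeight_transposeAssign {n m : ℕ} (p : ℝ) (ω : Fin m → Finset (Fin n)) :
    assignWeight n m p (transposeAssign ω) = ∏ i, featureWeight n p (ω i) := by
  simp only [assignWeight, featureWeight, ← prod_ite_mem_eq_pow_mul_pow, mem_transposeAssign]
  exact Finset.prod_comm

lemma rigProb_eq_seqExp (n m : ℕ) (p : ℝ) (A : Set (SimpleGraph (Fin n))) :
    rigProb n m p A = seqExp (featureWeight n p) m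
      (fun ω => if rigGraph n m (transposeAssign ω) ∈ A then 1 else 0) := by
  unfold rigProb seqExp
  rw [← (transposeEquiv n m).sum_comp]
  refine Finset.sum_congr rfl fun ω _ => ?_
  change (if rigGraph n m (transposeAssign ω) ∈ A then
    assignWeight n m p (transposeAssign ω) else 0) = _
  rw [assignWeight_transposeAssign, mul_ite, mul_one, mul_zero]

lemma rigProb_le_one (n m : ℕ) {p : ℝ} (h0 : 0 ≤ p) (h1 : p ≤ 1)
    (A : Set (SimpleGraph (Fin n))) : rigProb n m p A ≤ 1 := by
  rw [rigProb_eq_seqExp]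
  refine (seqExp_mono (featureWeight_nonneg n h0 h1) (ψ := fun _ => 1) fun ω => ?_).trans
    (seqExp_const (sum_featureWeight n p) m 1).le
  split_ifs <;> norm_num

/-- The two-element subsets of the vertex set. -/
def vertexPairs (n : ℕ) : Finset (Finset (Fin n)) := Finset.powersetCard 2 Finset.univ

lemma card_vertexPairs (n : ℕ) : (vertexPairs n).card = n.choose 2 := by
  simp [vertexPairs]

/-- The graph whose edges are the two-element sets in `T`. -/
def pairGraph {n : ℕ} (T : Finset (Finset (Fin n))) : SimpleGraph (Fin n) :=
  SimpleGraph.fromRel (fun u v => {u, v} ∈ T)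

lemma pairGraph_adj {n : ℕ} (T : Finset (Finset (Fin n))) (u v : Fin n) :
    (pairGraph T).Adj u v ↔ u ≠ v ∧ {u, v} ∈ T := by
  simp [pairGraph, Finset.pair_comm v u]

lemma pairGraph_mono {n : ℕ} {S T : Finset (Finset (Fin n))} (h : S ⊆ T) :
    pairGraph S ≤ pairGraph T := fun u v => by
  simp only [pairGraph_adj]
  exact fun ⟨h1, h2⟩ => ⟨h1, h h2⟩

lemma pairGraph_hits_le_rigGraph {n m : ℕ} (ω : Fin m → Finset (Fin n)) :
    pairGraph (hits (vertexPairs n) ω) ≤ rigGraph n m (transposeAssign ω) := fun u v => by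
  rw [pairGraph_adj, rigGraph, SimpleGraph.fromRel_adj]
  rintro ⟨huv, h⟩
  obtain ⟨i, hi⟩ := (mem_hits.1 h).2
  refine ⟨huv, Or.inl ⟨i, ?_⟩⟩
  simp [mem_transposeAssign, hi]

lemma sym2_toFinset_injective {V : Type*} [DecidableEq V] :
    Function.Injective (Sym2.toFinset : Sym2 V → Finset V) := fun x y h => by
  ext a
  rw [← Sym2.mem_toFinset, h, Sym2.mem_toFinset]

lemma image_edgeSet_pairGraph {n : ℕ} {T : Finset (Finset (Fin n))} (hT : T ⊆ vertexPairs n) :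
    Sym2.toFinset '' (pairGraph T).edgeSet = T := by
  ext b
  constructor
  · rintro ⟨e, he, rfl⟩
    induction e with
    | h u v =>
      rw [SimpleGraph.mem_edgeSet, pairGraph_adj] at he
      simpa [Sym2.toFinset_mk_eq] using he.2
  · intro hb
    obtain ⟨u, v, huv, rfl⟩ := Finset.card_eq_two.1 (Finset.mem_powersetCard.1 (hT hb)).2
    exact ⟨s(u, v), (pairGraph_adj T u v).2 ⟨huv, hb⟩, Sym2.toFinset_mk_eq⟩

lemma ncard_edgeSet_pairGraph {n : ℕ} {T : Finset (Finset (Fin n))} (hT : T ⊆ vertexPairs n) :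
    (pairGraph T).edgeSet.ncard = T.card := by
  rw [← Set.ncard_image_of_injective _ sym2_toFinset_injective, image_edgeSet_pairGraph hT,
    Set.ncard_coe_finset]

lemma exists_pairGraph_eq {n : ℕ} (G : SimpleGraph (Fin n)) :
    ∃ T ⊆ vertexPairs n, pairGraph T = G := by
  refine ⟨(vertexPairs n).filter (· ∈ Sym2.toFinset '' G.edgeSet), Finset.filter_subset _ _, ?_⟩
  ext u v
  have hmem : {u, v} ∈ Sym2.toFinset '' G.edgeSet ↔ G.Adj u v := by
    rw [← Sym2.toFinset_mk_eq, sym2_toFinset_injective.mem_set_image, SimpleGraph.mem_edgeSet]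
  rw [pairGraph_adj, Finset.mem_filter, hmem]
  refine ⟨fun h => h.2.2, fun h => ⟨h.ne, ?_, h⟩⟩
  simp [vertexPairs, Finset.mem_powersetCard, Finset.card_pair h.ne]

lemma erProb_eq_sum (n : ℕ) (q : ℝ) (A : Set (SimpleGraph (Fin n))) :
    erProb n q A = ∑ T ∈ (vertexPairs n).powerset, if pairGraph T ∈ A then
      q ^ T.card * (1 - q) ^ ((vertexPairs n).card - T.card) else 0 := by
  unfold erProb
  symm
  refine Finset.sum_bij (fun T _ => pairGraph T) (fun _ _ => Finset.mem_univ _) ?_ ?_ ?_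
  · intro S hS T hT h
    rw [← Finset.coe_inj, ← image_edgeSet_pairGraph (Finset.mem_powerset.1 hS), h,
      image_edgeSet_pairGraph (Finset.mem_powerset.1 hT)]
  · intro G _
    obtain ⟨T, hT, h⟩ := exists_pairGraph_eq G
    exact ⟨T, Finset.mem_powerset.2 hT, h⟩
  · intro T hT
    rw [erDist, ncard_edgeSet_pairGraph (Finset.mem_powerset.1 hT), card_vertexPairs]

lemma featureWeight_of_mem_vertexPairs {n : ℕ} (p : ℝ) (b : Finset (Fin n))
    (hb : b ∈ vertexPairs n) : featureWeight n p b = p ^ 2 * (1 - p) ^ (n - 2) := by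
  rw [featureWeight, (Finset.mem_powersetCard.1 hb).2]

/-- Comparison of the Erdős–Rényi and random intersection graphs at fixed parameters. -/
lemma erProb_le_rigProb_add (n m : ℕ) {p : ℝ} (h0 : 0 ≤ p) (h1 : p ≤ 1)
    {A : Set (SimpleGraph (Fin n))} (hA : ∀ G G', G ∈ A → G ≤ G' → G' ∈ A)
    {r : ℝ} (hr : r = p ^ 2 * (1 - p) ^ (n - 2)) (hq : n.choose 2 * r < 1)
    {μ : ℝ} (hμ0 : 0 ≤ μ) (hμ : μ ≤ m) :
    erProb n (1 - Real.exp (-(μ * r))) A ≤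
      rigProb n m p A + √(n.choose 2 * r / (1 - n.choose 2 * r)) := by
  have hρ := featureWeight_nonneg n h0 h1
  have hle : hitProb (featureWeight n p) (vertexPairs n) (fun T => pairGraph T ∈ A) m ≤
      rigProb n m p A := by
    rw [rigProb_eq_seqExp]
    refine seqExp_mono hρ fun ω => ?_
    have := fun h => hA _ _ h (pairGraph_hits_le_rigGraph ω)
    split_ifs with h h' <;> first | exact absurd (this h) h' | norm_num
  have h := sum_indep_le_hitProb hρ (sum_featureWeight n p) (B := vertexPairs n) (r := r)
    (fun b hb => by rw [featureWeight_of_mem_vertexPairs p b hb, hr])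
    (by rwa [card_vertexPairs]) (P := fun T => pairGraph T ∈ A)
    (fun S T hST hS => hA _ _ hS (pairGraph_mono hST)) m hμ0 hμ
  rw [erProb_eq_sum, sub_sub_cancel]
  rw [card_vertexPairs] at h ⊢
  linarith

lemma exp_neg_le_quadratic {y : ℝ} (hy : 0 ≤ y) : Real.exp (-y) ≤ 1 - y + y ^ 2 / 2 := by
  rw [Real.exp_neg, inv_le_iff_one_le_mul₀ (Real.exp_pos y)]
  have h := Real.quadratic_le_exp_of_nonneg hy
  have h2 : 0 ≤ 1 - y + y ^ 2 / 2 := by nlinarith [sq_nonneg (y - 1)]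
  nlinarith [mul_le_mul_of_nonneg_left h h2, sq_nonneg (y ^ 2)]

lemma erProb_le_rigProb_add_mul (n m : ℕ) (hn : 2 ≤ n) {p : ℝ} (h0 : 0 ≤ p) (hmp : m * p ^ 2 < 1)
    (hnp : n * p ≤ 1 / 4) {A : Set (SimpleGraph (Fin n))}
    (hA : ∀ G G', G ∈ A → G ≤ G' → G' ∈ A) :
    erProb n (m * p ^ 2 * (1 - ((n : ℝ) - 2) * p - m * p ^ 2 / 2)) A ≤
      rigProb n m p A + 2 * (n * p) := by
  have hn' : (2 : ℝ) ≤ n := by exact_mod_cast hn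
  have hp4 : p ≤ 1 / 4 := by nlinarith
  obtain ⟨r, hr⟩ : ∃ r, r = p ^ 2 * (1 - p) ^ (n - 2) := ⟨_, rfl⟩
  set x : ℝ := m * p ^ 2 with hx
  have hx0 : 0 ≤ x := by positivity
  set t : ℝ := 1 - ((n : ℝ) - 2) * p with ht
  have ht0 : 3 / 4 ≤ t := by nlinarith
  have ht1 : t ≤ 1 := by nlinarith [mul_nonneg (sub_nonneg.2 hn') h0]
  set q : ℝ := x * (t - x / 2) with hqdef
  have hq0 : 0 ≤ q := mul_nonneg hx0 (by linarith)
  have hbern : t ≤ (1 - p) ^ (n - 2) := by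
    have h := one_add_mul_le_pow (show (-2 : ℝ) ≤ -p by linarith) (n - 2)
    rw [Nat.cast_sub hn] at h
    push_cast at h
    rw [sub_eq_add_neg 1 p]
    linarith
  have hpow1 : (1 - p) ^ (n - 2) ≤ 1 := pow_le_one₀ (by linarith) (by linarith)
  have hr0 : 0 ≤ r := by rw [hr]; exact mul_nonneg (sq_nonneg _) (by linarith)
  have hexp : Real.exp (-(m * r)) ≤ 1 - q := by
    have h1 : x * t ≤ m * r := by
      rw [hr, ← mul_assoc]; exact mul_le_mul_of_nonneg_left hbern hx0
    have h2 : 0 ≤ x * t := mul_nonneg hx0 (by linarith)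
    have h3 : (x * t) ^ 2 ≤ x ^ 2 := by gcongr; nlinarith
    calc Real.exp (-(m * r)) ≤ Real.exp (-(x * t)) := Real.exp_le_exp.2 (by linarith)
      _ ≤ 1 - x * t + (x * t) ^ 2 / 2 := exp_neg_le_quadratic h2
      _ ≤ 1 - q := by rw [hqdef]; nlinarith
  have hq1 : 0 < 1 - q := (Real.exp_pos _).trans_le hexp
  obtain ⟨μ, hμ0, hμ, hμr⟩ : ∃ μ : ℝ, 0 ≤ μ ∧ μ ≤ m ∧ Real.exp (-(μ * r)) = 1 - q := by
    rcases hr0.eq_or_lt with h | h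
    · refine ⟨0, le_rfl, Nat.cast_nonneg m, ?_⟩
      have : p = 0 := by
        rw [hr] at h
        rcases mul_eq_zero.1 h.symm with h | h
        · exact pow_eq_zero_iff two_ne_zero |>.1 h
        · linarith
      simp [hqdef, hx, this]
    · refine ⟨-Real.log (1 - q) / r, div_nonneg ?_ hr0, (div_le_iff₀ h).2 ?_, ?_⟩
      · exact neg_nonneg.2 (Real.log_nonpos hq1.le (by linarith))
      · linarith [(Real.le_log_iff_exp_le hq1).2 hexp]
      · rw [div_mul_cancel₀ _ h.ne', neg_neg, Real.exp_log hq1]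
  have hchoose : (n.choose 2 : ℝ) * r ≤ (n * p) ^ 2 / 2 := by
    have h1 : (n.choose 2 : ℝ) ≤ n ^ 2 / 2 := by
      rw [Nat.cast_choose_two]; nlinarith
    have h2 : r ≤ p ^ 2 := by
      rw [hr]; exact mul_le_of_le_one_right (sq_nonneg _) hpow1
    calc (n.choose 2 : ℝ) * r ≤ n ^ 2 / 2 * p ^ 2 := by gcongr
      _ = _ := by ring
  have hnp0 : 0 ≤ n * p := mul_nonneg (Nat.cast_nonneg n) h0
  have hnp2 : (n * p) ^ 2 ≤ 1 / 16 := by nlinarith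
  have h := erProb_le_rigProb_add n m h0 (by linarith) hA hr (by linarith) hμ0 hμ
  rw [hμr, sub_sub_cancel] at h
  refine h.trans (add_le_add_right ?_ _)
  rw [Real.sqrt_le_left (by linarith), div_le_iff₀ (by linarith)]
  nlinarith

/-- Coupling lemma, case `np = o(1)`: if `A` is an increasing graph property,
`m p² < 1`, `n p → 0`, and `p̂₋ = m p² (1 - (n-2) p - m p²/2)`, then whp-transfer holds:
if `G(n, p̂₋) ∈ A` whp, then the random intersection graph `G(n, m, p) ∈ A` whp. -/
theorem rig_coupling_small_np
    (A : ∀ n : ℕ, Set (SimpleGraph (Fin n)))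
    (hIso : ∀ (n : ℕ) (G G' : SimpleGraph (Fin n)), Nonempty (G ≃g G') →
      G ∈ A n → G' ∈ A n)
    (hIncr : ∀ (n : ℕ) (G G' : SimpleGraph (Fin n)), G ∈ A n → G ≤ G' → G' ∈ A n)
    (m : ℕ → ℕ) (p : ℕ → ℝ)
    (hp0 : ∀ n, 0 ≤ p n) (hp1 : ∀ n, p n ≤ 1)
    (hmp : ∀ n, (m n : ℝ) * p n ^ 2 < 1)
    (hnp : Tendsto (fun n : ℕ => (n : ℝ) * p n) atTop (nhds 0))
    (phat : ℕ → ℝ)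
    (hphat : ∀ n, phat n =
      (m n : ℝ) * p n ^ 2 * (1 - ((n : ℝ) - 2) * p n - (m n : ℝ) * p n ^ 2 / 2))
    (hER : Tendsto (fun n => erProb n (phat n) (A n)) atTop (nhds 1)) :
    Tendsto (fun n => rigProb n (m n) (p n) (A n)) atTop (nhds 1) := by
  have hlow : Tendsto (fun n => erProb n (phat n) (A n) - 2 * ((n : ℝ) * p n)) atTop (nhds 1) := by
    simpa using hER.sub (hnp.const_mul 2)
  refine tendsto_of_tendsto_of_tendsto_of_le_of_le' hlow tendsto_const_nhds ?_
    (Eventually.of_forall fun n => rigProb_le_one n (m n) (hp0 n) (hp1 n) (A n))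
  filter_upwards [hnp.eventually_le_const (show (0 : ℝ) < 1 / 4 by norm_num),
    eventually_ge_atTop 2] with n hn hn2
  rw [hphat n, sub_le_iff_le_add]
  exact erProb_le_rigProb_add_mul n (m n) hn2 (hp0 n) (hmp n) hn (hIncr n)
end
end
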